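/- Let n ≠ m with n, m ≥ 2, and let Γ_0 = F_n × F_m be the direct product of free groups, endowed with the generating set given by the union of the standard free generating sets of the two factors (so the Cayley graph of Γ_0 is the product of the regular trees of degrees 2n and 2m). Fix α_1, α_2 > 0 with α_1 + α_2 = 1 and let μ_0 = α_1 μ̂_1 + α_2 μ̂_2, where μ̂_i is the lazy simple random walk on the i-th factor (mass 1/2 at the identity and mass 1/(4k) at each of the 2k standard generators and inverses of F_k). Let R_0 be the radius of convergence of the Green function of μ_0. Then there exists r_0 ∈ (1, R_0) such that the Poincaré series Θ_{Γ_0}(r, ω_{Γ_0}(r)) = Σ_{x∈Γ_0} G_0(e,x|r) e^{−ω_{Γ_0}(r)|x|} diverges for every 0 < r ≤ r_0 and converges for every r_0 < r < R_0. -/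

import Mathlib

open scoped Pointwise Classical
open Filter

namespace GreenGrowth

variable {G : Type*} [Group G]

/-- Word length with respect to a finite generating set `S` (symmetrized). -/
noncomputable def wordLength (S : Finset G) (x : G) : ℕ :=
  sInf {n : ℕ | x ∈ ((S : Set G) ∪ (S : Set G)⁻¹) ^ n}

/-- `n`-step distribution of the `μ`-random walk: the `n`-fold convolution power of `μ`,
so that `p_n(x, y) = convPow μ n (x⁻¹ * y)`. -/
noncomputable def convPow (μ : G → ℝ) : ℕ → G → ℝ
  | 0 => fun x => if x = 1 then 1 else 0
  | n + 1 => fun x => ∑' y : G, μ y * convPow μ n (y⁻¹ * x)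

/-- The Green function `G(e, x | r)`. -/
noncomputable def green (μ : G → ℝ) (r : ℝ) (x : G) : ℝ :=
  ∑' n : ℕ, r ^ n * convPow μ n x

/-- `μ` is a probability measure on `G`. -/
def IsProbMeasure (μ : G → ℝ) : Prop := (∀ x, 0 ≤ μ x) ∧ HasSum μ 1

/-- `μ` is admissible: its support generates `G` as a semigroup, i.e. every element of `G`
is reached with positive probability at some time. -/
def IsAdmissible (μ : G → ℝ) : Prop := ∀ x : G, ∃ n : ℕ, 0 < convPow μ n x

/-- `μ` is symmetric. -/
def IsSymm (μ : G → ℝ) : Prop := ∀ x : G, μ x⁻¹ = μ x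

/-- The spectral radius of the `μ`-random walk. -/
noncomputable def spectralRadius (μ : G → ℝ) : ℝ :=
  limsup (fun n : ℕ => (convPow μ n 1) ^ ((n : ℝ)⁻¹)) atTop

/-- `R`, the radius of convergence of the Green function: the inverse of the
spectral radius. -/
noncomputable def greenRadius (μ : G → ℝ) : ℝ := (spectralRadius μ)⁻¹

/-- The `μ`-random walk is transient at the spectral radius: the Green function
`G(x, y | r)` is finite for all `x, y` and all `0 < r ≤ R`. -/
def TransientAtSpectralRadius (μ : G → ℝ) : Prop :=
  ∀ r : ℝ, 0 < r → r ≤ greenRadius μ →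
    ∀ x : G, Summable (fun n : ℕ => r ^ n * convPow μ n x)

/-- `H_r(n) = Σ_{x ∈ S_n} G(e, x | r)`, the sum of the Green function over the sphere
of radius `n`. -/
noncomputable def greenSphereSum (S : Finset G) (μ : G → ℝ) (r : ℝ) (n : ℕ) : ℝ :=
  ∑' x : G, if wordLength S x = n then green μ r x else 0

/-- `ω_Γ(r) = limsup (1/n) log H_r(n)`, the growth rate of the Green function. -/
noncomputable def greenGrowthRate (S : Finset G) (μ : G → ℝ) (r : ℝ) : ℝ :=
  limsup (fun n : ℕ => Real.log (greenSphereSum S μ r n) / n) atTop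

/-- The cardinality of the sphere of radius `n`. -/
noncomputable def sphereCard (S : Finset G) (n : ℕ) : ℕ :=
  Nat.card {x : G // wordLength S x = n}

/-- The volume growth rate `v = limsup (1/n) log #S_n`. -/
noncomputable def volumeGrowthRate (S : Finset G) : ℝ :=
  limsup (fun n : ℕ => Real.log (sphereCard S n) / n) atTop

end GreenGrowth

namespace GreenGrowth

/-- The direct product of free groups `F_n × F_m`. -/
abbrev BiFree (n m : ℕ) := FreeGroup (Fin n) × FreeGroup (Fin m)

/-- The lazy simple random walk on the free group `F_k`: mass `1/2` at the identity
and mass `1/(4k)` at each of the `2k` standard generators and their inverses. -/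
noncomputable def lazyFreeSRW (k : ℕ) (x : FreeGroup (Fin k)) : ℝ :=
  if x = 1 then 1 / 2
  else if ∃ i : Fin k, x = FreeGroup.of i ∨ x = (FreeGroup.of i)⁻¹ then 1 / (4 * k)
  else 0

/-- The generating set of `F_n × F_m` given by the union of the standard free
generating sets of the two factors. -/
noncomputable def biFreeGens (n m : ℕ) : Finset (BiFree n m) :=
  (Finset.univ.image fun i : Fin n => ((FreeGroup.of i, 1) : BiFree n m)) ∪
    (Finset.univ.image fun j : Fin m => ((1, FreeGroup.of j) : BiFree n m))

/-- The measure `μ₀ = α₁ μ̂₁ + α₂ μ̂₂` on `F_n × F_m`, mixture of the lazy simple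
random walks on the two factors. -/
noncomputable def biFreeMu (n m : ℕ) (α₁ α₂ : ℝ) (z : BiFree n m) : ℝ :=
  α₁ * (if z.2 = 1 then lazyFreeSRW n z.1 else 0) +
    α₂ * (if z.1 = 1 then lazyFreeSRW m z.2 else 0)

end GreenGrowth

namespace GreenGrowth

/-! ### The radial operator on a regular tree -/

/-- Action of the lazy simple random walk of the `(q + 1)`-regular tree on radial functions. -/
noncomputable def radialOp (q : ℝ) (u : ℕ → ℝ) : ℕ → ℝ
  | 0 => u 0 / 2 + u 1 / 2
  | n + 1 => u (n + 1) / 2 + (u n + q * u (n + 2)) / (2 * (q + 1))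

/-- The eigenvalue of `radialOp q` away from the root on the function `t ^ n`. -/
noncomputable def treeEigenvalue (q t : ℝ) : ℝ := 1 / 2 + (t⁻¹ + q * t) / (2 * (q + 1))

/-- The critical ratio of the `(q + 1)`-regular tree. -/
noncomputable def critRatio (q : ℝ) : ℝ := (√q)⁻¹

lemma critRatio_pos {q : ℝ} (hq : 1 < q) : 0 < critRatio q :=
  inv_pos.2 (Real.sqrt_pos.2 (by linarith))

lemma mul_critRatio_sq {q : ℝ} (hq : 1 < q) : q * critRatio q ^ 2 = 1 := by
  have : √q ^ 2 = q := Real.sq_sqrt (by linarith)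
  have h0 : 0 < √q := Real.sqrt_pos.2 (by linarith)
  rw [critRatio, inv_pow, this, mul_inv_cancel₀ (by linarith)]

lemma critRatio_lt_one {q : ℝ} (hq : 1 < q) : critRatio q < 1 := by
  have h := mul_critRatio_sq hq
  have h0 := critRatio_pos hq
  by_contra! h1
  have h2 : 1 ≤ critRatio q ^ 2 := one_le_pow₀ h1
  nlinarith

lemma critRatio_anti {p q : ℝ} (hp : 1 < p) (hpq : p < q) : critRatio q < critRatio p :=
  inv_strictAnti₀ (Real.sqrt_pos.2 (by linarith)) (Real.sqrt_lt_sqrt (by linarith) hpq)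

lemma one_lt_mul_sq {q t : ℝ} (hq : 1 < q) (ht : critRatio q < t) : 1 < q * t ^ 2 := by
  have h := mul_critRatio_sq hq
  have h0 := critRatio_pos hq
  have : critRatio q ^ 2 < t ^ 2 := by gcongr
  nlinarith

lemma treeEigenvalue_one {q : ℝ} (hq : 1 < q) : treeEigenvalue q 1 = 1 := by
  have : q + 1 ≠ 0 := by linarith
  rw [treeEigenvalue]; field_simp; ring

lemma treeEigenvalue_lt {q t t' : ℝ} (hq : 1 < q) (ht : critRatio q ≤ t) (htt : t < t') :
    treeEigenvalue q t < treeEigenvalue q t' := by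
  have h := mul_critRatio_sq hq
  have h0 := critRatio_pos hq
  have ht0 : 0 < t := by linarith
  have ht0' : 0 < t' := by linarith
  have h1 : 1 < q * (t * t') := by
    rw [← h, sq]
    have : critRatio q * critRatio q < t * t' :=
      mul_lt_mul' ht (by linarith) h0.le ht0
    exact mul_lt_mul_of_pos_left this (by linarith)
  have h2 : 0 < t'⁻¹ + q * t' - (t⁻¹ + q * t) := by
    have : t'⁻¹ + q * t' - (t⁻¹ + q * t) = (t' - t) * (q * (t * t') - 1) / (t * t') := by
      field_simp; ring
    rw [this]
    have : 0 < t' - t := by linarith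
    have : 0 < q * (t * t') - 1 := by linarith
    positivity
  have : (t⁻¹ + q * t) / (2 * (q + 1)) < (t'⁻¹ + q * t') / (2 * (q + 1)) := by
    apply div_lt_div_of_pos_right <;> linarith
  rw [treeEigenvalue, treeEigenvalue]; linarith

lemma treeEigenvalue_le {q t t' : ℝ} (hq : 1 < q) (ht : critRatio q ≤ t) (htt : t ≤ t') :
    treeEigenvalue q t ≤ treeEigenvalue q t' := by
  rcases htt.eq_or_lt with rfl | h
  · exact le_rfl
  · exact (treeEigenvalue_lt hq ht h).le

lemma treeEigenvalue_pos {q t : ℝ} (hq : 1 < q) (ht : 0 < t) : 0 < treeEigenvalue q t := by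
  have : 0 < q := by linarith
  unfold treeEigenvalue; positivity

lemma le_treeEigenvalue {q t : ℝ} (hq : 1 < q) (ht : 0 < t) : t / 4 ≤ treeEigenvalue q t := by
  have h1 : 0 < t⁻¹ := inv_pos.2 ht
  have h2 : q * t / (2 * (q + 1)) ≤ (t⁻¹ + q * t) / (2 * (q + 1)) := by
    apply div_le_div_of_nonneg_right <;> linarith
  have h3 : t / 4 ≤ q * t / (2 * (q + 1)) := by
    rw [div_le_div_iff₀ (by norm_num) (by linarith)]; nlinarith
  unfold treeEigenvalue; linarith

lemma continuousOn_treeEigenvalue (q : ℝ) {a b : ℝ} (ha : 0 < a) :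
    ContinuousOn (treeEigenvalue q) (Set.Icc a b) := by
  unfold treeEigenvalue
  have : ContinuousOn (fun t : ℝ => t⁻¹) (Set.Icc a b) :=
    continuousOn_inv₀.mono fun x hx => by
      simp only [Set.mem_compl_iff, Set.mem_singleton_iff]; linarith [hx.1]
  fun_prop

lemma radialOp_zero (q : ℝ) (u : ℕ → ℝ) : radialOp q u 0 = u 0 / 2 + u 1 / 2 := rfl

lemma radialOp_succ (q : ℝ) (u : ℕ → ℝ) (n : ℕ) :
    radialOp q u (n + 1) = u (n + 1) / 2 + (u n + q * u (n + 2)) / (2 * (q + 1)) := rfl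

lemma radialOp_mono {q : ℝ} (hq : 1 < q) {u v : ℕ → ℝ} (h : ∀ n, u n ≤ v n) (n : ℕ) :
    radialOp q u n ≤ radialOp q v n := by
  cases n with
  | zero => rw [radialOp_zero, radialOp_zero]; linarith [h 0, h 1]
  | succ n =>
    rw [radialOp_succ, radialOp_succ]
    have : q * u (n + 2) ≤ q * v (n + 2) := mul_le_mul_of_nonneg_left (h _) (by linarith)
    have h2 : (u n + q * u (n + 2)) / (2 * (q + 1)) ≤ (v n + q * v (n + 2)) / (2 * (q + 1)) := by
      apply div_le_div_of_nonneg_right <;> linarith [h n]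
    linarith [h (n + 1)]

/-- The spherical functions of the tree with growth `t ^ n`, `t` above the critical ratio. -/
lemma exists_spherical {q t : ℝ} (hq : 1 < q) (ht : critRatio q < t) :
    ∃ (φ : ℕ → ℝ) (a b : ℝ), 0 < a ∧ 0 < b ∧
      (∀ n, radialOp q φ n = treeEigenvalue q t * φ n) ∧
      (∀ n, a * t ^ n ≤ φ n) ∧ ∀ n, φ n ≤ b * t ^ n := by
  have h0 := critRatio_pos hq
  have ht0 : 0 < t := by linarith
  have hqt := one_lt_mul_sq hq ht
  have hq0 : 0 < q := by linarith
  set t' : ℝ := (q * t)⁻¹ with ht'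
  have hpos : 0 < t' := by positivity
  have hqtt : q * t * t' = 1 := by rw [ht']; field_simp
  have htt : t' < t := by
    by_contra! h; nlinarith [mul_le_mul_of_nonneg_left h (by positivity : 0 ≤ q * t)]
  have ht1 : t' < 1 := by
    by_contra! h
    have h2 : q * t * 1 ≤ q * t * t' := mul_le_mul_of_nonneg_left h (by positivity)
    nlinarith [mul_lt_mul_of_pos_left hq ht0]
  set A : ℝ := q * t - t' with hA
  set B : ℝ := t⁻¹ - t with hB
  have hA0 : 0 < A := by
    by_contra! h
    have : q * t < 1 := by linarith
    nlinarith
  have hAB : 0 < A - B := by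
    have e : t⁻¹ = q * t' := by rw [ht']; field_simp
    rw [hA, hB, e]; nlinarith
  refine ⟨fun n => A * t ^ n - B * t' ^ n, min A (A - B), max A (A - B),
    lt_min hA0 hAB, lt_max_of_lt_left hA0, ?_, ?_, ?_⟩
  · have hti : t'⁻¹ = q * t := by rw [ht', inv_inv]
    have e : q * t' = t⁻¹ := by rw [ht']; field_simp
    intro n
    cases n with
    | zero =>
      rw [radialOp_zero, treeEigenvalue]
      simp only [pow_zero, pow_one, hA, hB, ht']
      field_simp
      ring
    | succ n =>
      rw [radialOp_succ, treeEigenvalue]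
      have e1 : q * t' ^ (n + 2) = t⁻¹ * t' ^ (n + 1) := by rw [← e]; ring
      have e2 : t' ^ n = q * t * t' ^ (n + 1) := by
        rw [← hti]; field_simp; ring
      have e3 : t ^ n = t⁻¹ * t ^ (n + 1) := by field_simp; ring
      have : (A * t ^ n - B * t' ^ n + q * (A * t ^ (n + 2) - B * t' ^ (n + 2)))
          = (t⁻¹ + q * t) * (A * t ^ (n + 1) - B * t' ^ (n + 1)) := by
        linear_combination A * e3 - B * e2 - B * e1
      rw [this]; ring
  · intro n
    have h1 : t' ^ n ≤ t ^ n := by gcongr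
    have h2 : 0 < t' ^ n := by positivity
    have h3 : 0 < t ^ n := by positivity
    rcases le_total 0 B with hb | hb
    · nlinarith [min_le_right A (A - B)]
    · nlinarith [min_le_left A (A - B)]
  · intro n
    have h1 : t' ^ n ≤ t ^ n := by gcongr
    have h2 : 0 < t' ^ n := by positivity
    have h3 : 0 < t ^ n := by positivity
    rcases le_total 0 B with hb | hb
    · nlinarith [le_max_left A (A - B)]
    · nlinarith [le_max_right A (A - B)]

/-- The defect of `radialOp q` at the critical eigenvalue on `u n * critRatio q ^ n`,
away from the root. -/
lemma critical_defect_succ {q : ℝ} (hq : 1 < q) (u : ℕ → ℝ) (n : ℕ) :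
    treeEigenvalue q (critRatio q) * (u (n + 1) * critRatio q ^ (n + 1)) -
        radialOp q (fun n => u n * critRatio q ^ n) (n + 1) =
      (2 * (q + 1) * critRatio q)⁻¹ * (2 * u (n + 1) - u n - u (n + 2)) *
        critRatio q ^ (n + 1) := by
  have h0 := critRatio_pos hq
  have h := mul_critRatio_sq hq
  rw [radialOp_succ, treeEigenvalue]
  set t := critRatio q
  have hq1 : q + 1 ≠ 0 := by linarith
  have e : q * t = t⁻¹ := by field_simp; linarith
  have e1 : q * (u (n + 2) * t ^ (n + 2)) = t⁻¹ * u (n + 2) * t ^ (n + 1) := by rw [← e]; ring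
  have e3 : t ^ n = t⁻¹ * t ^ (n + 1) := by field_simp; ring
  rw [e1, e, e3]
  field_simp
  ring

/-- The defect of `radialOp q` at the critical eigenvalue at the root. -/
lemma critical_defect_zero {q : ℝ} (hq : 1 < q) (u : ℕ → ℝ) :
    treeEigenvalue q (critRatio q) * (u 0 * critRatio q ^ 0) -
        radialOp q (fun n => u n * critRatio q ^ n) 0 =
      (2 * (q + 1) * critRatio q)⁻¹ * (2 * u 0 - (1 + q⁻¹) * u 1) := by
  have h0 := critRatio_pos hq
  have h := mul_critRatio_sq hq
  rw [radialOp_zero, treeEigenvalue]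
  set t := critRatio q
  have hq1 : q + 1 ≠ 0 := by linarith
  have hq0 : q ≠ 0 := by linarith
  have e : q⁻¹ = t ^ 2 := by field_simp; linarith
  rw [e]
  field_simp
  linear_combination (u 0 - u 1) * h

lemma critical_superharmonic {q : ℝ} (hq : 1 < q) (n : ℕ) :
    radialOp q (fun n => critRatio q ^ n) n ≤
      treeEigenvalue q (critRatio q) * critRatio q ^ n := by
  have h0 := critRatio_pos hq
  have hq0 : 0 < q := by linarith
  cases n with
  | zero =>
    have h := critical_defect_zero hq fun _ => 1
    simp only [one_mul] at h
    have : q⁻¹ < 1 := inv_lt_one_of_one_lt₀ hq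
    have : 0 ≤ (2 * (q + 1) * critRatio q)⁻¹ * (2 * 1 - (1 + q⁻¹) * 1) := by
      apply mul_nonneg (by positivity); linarith
    linarith
  | succ n =>
    have h := critical_defect_succ hq (fun _ => 1) n
    simp only [one_mul] at h
    have : (2 * (q + 1) * critRatio q)⁻¹ * (2 * 1 - 1 - 1) * critRatio q ^ (n + 1) = 0 := by ring
    linarith

/-- Superharmonic majorants: for `t` at or above the critical ratio. -/
lemma exists_superharmonic {q t : ℝ} (hq : 1 < q) (ht : critRatio q ≤ t) :
    ∃ (φ : ℕ → ℝ) (a : ℝ), 0 < a ∧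
      (∀ n, radialOp q φ n ≤ treeEigenvalue q t * φ n) ∧ ∀ n, a * t ^ n ≤ φ n := by
  rcases ht.eq_or_lt with rfl | h
  · exact ⟨_, 1, one_pos, critical_superharmonic hq, fun n => by simp⟩
  · obtain ⟨φ, a, b, ha, -, h1, h2, -⟩ := exists_spherical hq h
    exact ⟨φ, a, ha, fun n => (h1 n).le, h2⟩

/-- At the critical ratio there are test functions with bounded defect and arbitrarily large
value at the root. -/
lemma exists_critical_growth {q : ℝ} (hq : 1 < q) :
    ∃ C : ℝ, 0 ≤ C ∧ ∀ N : ℝ, 0 ≤ N → ∃ (h : ℕ → ℝ) (M : ℝ), h 0 = N ∧ 0 ≤ M ∧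
      (∀ n, h n ≤ M * critRatio q ^ n) ∧
      ∀ n, treeEigenvalue q (critRatio q) * h n - radialOp q h n ≤ C * critRatio q ^ n := by
  have h0 := critRatio_pos hq
  have hq0 : 0 < q := by linarith
  set b : ℝ := (q - 1) / (q + 1) with hb
  have hb0 : 0 ≤ b := div_nonneg (by linarith) (by linarith)
  have hqi : q⁻¹ < 1 := inv_lt_one_of_one_lt₀ hq
  have hqi0 : 0 < q⁻¹ := by positivity
  refine ⟨(2 * (q + 1) * critRatio q)⁻¹ * 2, by positivity, fun N hN => ?_⟩
  refine ⟨fun n => (N * (1 + b * n) - (n : ℝ) ^ 2) * critRatio q ^ n, N + (N * b) ^ 2,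
    by simp, by positivity, fun n => ?_, fun n => ?_⟩
  · apply mul_le_mul_of_nonneg_right _ (by positivity)
    nlinarith [sq_nonneg ((n : ℝ) - N * b / 2), sq_nonneg (N * b)]
  · cases n with
    | zero =>
      have h := critical_defect_zero hq fun n => N * (1 + b * n) - (n : ℝ) ^ 2
      rw [h, pow_zero, mul_one]
      apply mul_le_mul_of_nonneg_left _ (by positivity)
      have : (1 + q⁻¹) * (1 + b) = 2 := by rw [hb]; field_simp; ring
      push_cast
      have e : 2 * (N * (1 + b * 0) - 0 ^ 2) - (1 + q⁻¹) * (N * (1 + b * 1) - 1 ^ 2)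
        = 1 + q⁻¹ := by linear_combination -N * this
      linarith
    | succ n =>
      have h := critical_defect_succ hq (fun n => N * (1 + b * n) - (n : ℝ) ^ 2) n
      rw [h]
      apply le_of_eq
      push_cast
      ring

/-- Below the critical ratio, `t ^ n` is dominated by the defect of a nonnegative function. -/
lemma exists_subcritical_potential {q t : ℝ} (hq : 1 < q) (ht0 : 0 < t) (ht : t < critRatio q) :
    ∃ h : ℕ → ℝ, (∀ n, 0 ≤ h n) ∧
      ∀ n, t ^ n ≤ treeEigenvalue q (critRatio q) * h n - radialOp q h n := by
  have h0 := critRatio_pos hq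
  have hq0 : 0 < q := by linarith
  have hqi : q⁻¹ < 1 := inv_lt_one_of_one_lt₀ hq
  have hqi0 : 0 < q⁻¹ := by positivity
  set κ := (2 * (q + 1) * critRatio q)⁻¹ with hκ
  have hκ0 : 0 < κ := by positivity
  set θ := t / critRatio q with hθ
  have hθ0 : 0 < θ := by positivity
  have hθ1 : θ < 1 := (div_lt_one h0).2 ht
  have htθ : θ * critRatio q = t := by rw [hθ]; field_simp
  have h1θ : 0 < 1 - θ := by linarith
  set D := θ / (κ * (1 - θ) ^ 2) with hD
  have hD0 : 0 < D := by positivity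
  have hDe : κ * D * (1 - θ) ^ 2 = θ := by rw [hD]; field_simp
  set C := (κ⁻¹ + 2 * D) / (1 - q⁻¹) with hC
  have h1q : 0 < 1 - q⁻¹ := by linarith
  have hCe : C * (1 - q⁻¹) = κ⁻¹ + 2 * D := div_mul_cancel₀ _ h1q.ne'
  have hκi : 0 < κ⁻¹ := by positivity
  have hC0 : 0 < C := by positivity
  have hCD : D ≤ C := by nlinarith
  refine ⟨fun n => (C - D * θ ^ n) * critRatio q ^ n, fun n => ?_, fun n => ?_⟩
  · apply mul_nonneg _ (by positivity)
    have : θ ^ n ≤ 1 := pow_le_one₀ hθ0.le hθ1.le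
    nlinarith
  · cases n with
    | zero =>
      have h := critical_defect_zero hq fun n => C - D * θ ^ n
      rw [h, ← hκ]
      have h1 : κ * κ⁻¹ = 1 := mul_inv_cancel₀ hκ0.ne'
      have h2 : κ⁻¹ ≤ 2 * (C - D * θ ^ 0) - (1 + q⁻¹) * (C - D * θ ^ 1) := by
        have : 0 ≤ (1 + q⁻¹) * (D * θ) := by positivity
        rw [pow_zero, pow_one]; nlinarith
      have h3 := mul_le_mul_of_nonneg_left h2 hκ0.le
      rwa [h1] at h3
    | succ n =>
      have h := critical_defect_succ hq (fun n => C - D * θ ^ n) n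
      rw [h, ← hκ, ← htθ, mul_pow]
      apply mul_le_mul_of_nonneg_right _ (by positivity)
      apply le_of_eq
      linear_combination -(θ ^ n) * hDe

/-- Finitely supported functions that are almost subharmonic at the critical eigenvalue. -/
lemma exists_finite_subharmonic {q ε : ℝ} (hq : 1 < q) (hε : 0 < ε) :
    ∃ (h : ℕ → ℝ) (N : ℕ), (∀ n, 0 ≤ h n) ∧ 0 < h 0 ∧ (∀ n, N ≤ n → h n = 0) ∧
      ∀ n, (treeEigenvalue q (critRatio q) - ε) * h n ≤ radialOp q h n := by
  have h0 := critRatio_pos hq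
  have hq0 : 0 < q := by linarith
  have hqi : q⁻¹ < 1 := inv_lt_one_of_one_lt₀ hq
  have hqi0 : 0 < q⁻¹ := by positivity
  set κ := (2 * (q + 1) * critRatio q)⁻¹ with hκ
  have hκ0 : 0 < κ := by positivity
  obtain ⟨N, hN⟩ := exists_nat_gt (2 * κ / ε + (q + 1))
  have hN1 : 2 * κ ≤ ε * N := by
    have : 2 * κ / ε ≤ N := by linarith
    rw [div_le_iff₀ hε] at this; linarith
  have hN2 : q + 1 ≤ N := by
    have : 0 < 2 * κ / ε := by positivity
    linarith
  have hN3 : 2 ≤ N := by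
    have : (2 : ℝ) ≤ N := by linarith
    exact_mod_cast this
  set u : ℕ → ℝ := fun n => if n ≤ N then ((n : ℝ) + 1) * (N - n) else 0 with hu
  have hu0 : ∀ n, 0 ≤ u n := fun n => by
    simp only [hu]
    split_ifs with h
    · have : (n : ℝ) ≤ N := by exact_mod_cast h
      apply mul_nonneg <;> [positivity; linarith]
    · exact le_rfl
  have huN : ∀ n, N ≤ n → u n = 0 := fun n hn => by
    simp only [hu]
    split_ifs with h
    · rw [le_antisymm h hn]; simp
    · rfl
  have hnn : ∀ n, 0 ≤ u n * critRatio q ^ n := fun n => mul_nonneg (hu0 n) (by positivity)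
  refine ⟨fun n => u n * critRatio q ^ n, N, hnn, ?_, fun n hn => by simp [huN n hn], ?_⟩
  · simp only [hu]
    have : (0 : ℝ) < N := by linarith
    simpa using this
  · intro n
    cases n with
    | zero =>
      have h := critical_defect_zero hq u
      have e0 : u 0 = N := by simp [hu]
      have e1 : u 1 = 2 * (N - 1) := by
        simp only [hu]; rw [if_pos (by omega)]; push_cast; ring
      have h2 : 2 * u 0 - (1 + q⁻¹) * u 1 ≤ 0 := by
        rw [e0, e1]
        have : q⁻¹ * (N - 1) ≥ q⁻¹ * q := by
          apply mul_le_mul_of_nonneg_left _ hqi0.le; linarith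
        rw [inv_mul_cancel₀ hq0.ne'] at this
        linarith
      have h3 := mul_nonpos_of_nonneg_of_nonpos hκ0.le h2
      have h4 := mul_nonneg hε.le (hnn 0)
      simp only at h ⊢
      rw [sub_mul]
      linarith
    | succ n =>
      have h := critical_defect_succ hq u n
      rw [← hκ] at h
      rcases lt_or_ge (n + 1) N with hn | hn
      · have hn' : (n : ℝ) + 1 ≤ N - 1 := by
          have : ((n + 1 + 1 : ℕ) : ℝ) ≤ N := by exact_mod_cast hn
          push_cast at this; linarith
        have e : 2 * u (n + 1) - u n - u (n + 2) = 2 := by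
          simp only [hu]
          rw [if_pos (by omega), if_pos (by omega), if_pos (by omega)]; push_cast; ring
        have hl : (N : ℝ) ≤ u (n + 1) := by
          simp only [hu]
          rw [if_pos (by omega)]; push_cast
          have : (0 : ℝ) ≤ n := by positivity
          nlinarith
        have h2 : κ * 2 * critRatio q ^ (n + 1) ≤ ε * u (n + 1) * critRatio q ^ (n + 1) := by
          apply mul_le_mul_of_nonneg_right _ (by positivity)
          have := mul_le_mul_of_nonneg_left hl hε.le
          linarith
        rw [e] at h
        simp only at h ⊢
        rw [sub_mul]
        linarith
      · simp only [huN (n + 1) hn, zero_mul, mul_zero]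
        rw [radialOp_succ]
        have a1 := hnn (n + 1)
        have a2 := hnn n
        have a3 := hnn (n + 2)
        positivity

/-! ### The operator on the product of two trees -/

/-- Action of the mixture `α • P ⊗ 1 + β • 1 ⊗ Q` on functions of the two radii. -/
noncomputable def biradialOp (α β p q : ℝ) (w : ℕ → ℕ → ℝ) (a b : ℕ) : ℝ :=
  α * radialOp p (fun i => w i b) a + β * radialOp q (w a) b

/-- The expectation of `w` after `k` steps, started at the root. -/
noncomputable def biradialExp (α β p q : ℝ) (k : ℕ) (w : ℕ → ℕ → ℝ) : ℝ :=
  (biradialOp α β p q)^[k] w 0 0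

/-- The tensor product of two radial functions. -/
def tensor (f g : ℕ → ℝ) (a b : ℕ) : ℝ := f a * g b

/-- The weight `t ^ (a + b)`. -/
def powWeight (t : ℝ) : ℕ → ℕ → ℝ := tensor (fun n => t ^ n) (fun n => t ^ n)

lemma powWeight_pos {t : ℝ} (ht : 0 < t) (a b : ℕ) : 0 < powWeight t a b := by
  unfold powWeight tensor; positivity

lemma powWeight_mono {t t' : ℝ} (ht : 0 ≤ t) (h : t ≤ t') (a b : ℕ) :
    powWeight t a b ≤ powWeight t' a b := by
  unfold powWeight tensor
  have ht' := ht.trans h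
  exact mul_le_mul (pow_le_pow_left₀ ht h a) (pow_le_pow_left₀ ht h b) (by positivity)
    (by positivity)

lemma radialOp_linear (q x y : ℝ) (u v : ℕ → ℝ) (n : ℕ) :
    radialOp q (fun i => x * u i + y * v i) n = x * radialOp q u n + y * radialOp q v n := by
  cases n with
  | zero => simp only [radialOp_zero]; ring
  | succ n => simp only [radialOp_succ]; ring

lemma biradialOp_linear (α β p q x y : ℝ) (u v : ℕ → ℕ → ℝ) :
    biradialOp α β p q (fun a b => x * u a b + y * v a b) =
      fun a b => x * biradialOp α β p q u a b + y * biradialOp α β p q v a b := by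
  funext a b
  unfold biradialOp
  rw [radialOp_linear p x y (fun i => u i b) (fun i => v i b),
    radialOp_linear q x y (u a) (v a)]
  ring

lemma biradialOp_tensor (α β p q : ℝ) (f g : ℕ → ℝ) (a b : ℕ) :
    biradialOp α β p q (tensor f g) a b =
      α * radialOp p f a * g b + β * f a * radialOp q g b := by
  have h1 := radialOp_linear p (g b) 0 f f a
  have h2 := radialOp_linear q (f a) 0 g g b
  simp only [zero_mul, add_zero] at h1 h2
  have e1 : (fun i => tensor f g i b) = fun i => g b * f i := by
    funext i; simp only [tensor]; ring
  have e2 : tensor f g a = fun i => f a * g i := rfl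
  rw [biradialOp, e1, e2, h1, h2]; ring

lemma biradialExp_zero (α β p q : ℝ) (w : ℕ → ℕ → ℝ) :
    biradialExp α β p q 0 w = w 0 0 := rfl

lemma biradialExp_succ (α β p q : ℝ) (k : ℕ) (w : ℕ → ℕ → ℝ) :
    biradialExp α β p q (k + 1) w = biradialExp α β p q k (biradialOp α β p q w) := by
  rw [biradialExp, Function.iterate_succ_apply, biradialExp]

lemma biradialExp_add (α β p q : ℝ) (k l : ℕ) (w : ℕ → ℕ → ℝ) :
    biradialExp α β p q (k + l) w = biradialExp α β p q k ((biradialOp α β p q)^[l] w) := by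
  rw [biradialExp, Function.iterate_add_apply, biradialExp]

lemma biradialExp_linear (α β p q : ℝ) (k : ℕ) (x y : ℝ) (u v : ℕ → ℕ → ℝ) :
    biradialExp α β p q k (fun a b => x * u a b + y * v a b) =
      x * biradialExp α β p q k u + y * biradialExp α β p q k v := by
  induction k generalizing u v with
  | zero => rfl
  | succ k ih => rw [biradialExp_succ, biradialOp_linear, ih, biradialExp_succ, biradialExp_succ]

lemma biradialExp_smul (α β p q : ℝ) (k : ℕ) (x : ℝ) (u : ℕ → ℕ → ℝ) :
    biradialExp α β p q k (fun a b => x * u a b) = x * biradialExp α β p q k u := by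
  have := biradialExp_linear α β p q k x 0 u u
  simpa only [zero_mul, add_zero] using this

lemma biradialExp_swap (α β p q : ℝ) (k : ℕ) (w : ℕ → ℕ → ℝ) :
    biradialExp α β p q k w = biradialExp β α q p k (fun a b => w b a) := by
  induction k generalizing w with
  | zero => rfl
  | succ k ih =>
    rw [biradialExp_succ, biradialExp_succ, ih]
    congr 1
    funext a b
    exact add_comm _ _

lemma powWeight_swap (t : ℝ) : (fun a b => powWeight t b a) = powWeight t := by
  funext a b; exact mul_comm _ _

section Positive

variable {α β p q : ℝ}

lemma biradialOp_mono (hα : 0 < α) (hβ : 0 < β) (hp : 1 < p) (hq : 1 < q)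
    {u v : ℕ → ℕ → ℝ} (h : ∀ a b, u a b ≤ v a b) (a b : ℕ) :
    biradialOp α β p q u a b ≤ biradialOp α β p q v a b :=
  add_le_add (mul_le_mul_of_nonneg_left (radialOp_mono hp (fun i => h i b) a) hα.le)
    (mul_le_mul_of_nonneg_left (radialOp_mono hq (h a) b) hβ.le)

lemma biradialExp_mono (hα : 0 < α) (hβ : 0 < β) (hp : 1 < p) (hq : 1 < q) (k : ℕ)
    {u v : ℕ → ℕ → ℝ} (h : ∀ a b, u a b ≤ v a b) :
    biradialExp α β p q k u ≤ biradialExp α β p q k v := by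
  induction k generalizing u v with
  | zero => exact h 0 0
  | succ k ih =>
    rw [biradialExp_succ, biradialExp_succ]
    exact ih (biradialOp_mono hα hβ hp hq h)

lemma biradialExp_nonneg (hα : 0 < α) (hβ : 0 < β) (hp : 1 < p) (hq : 1 < q) (k : ℕ)
    {u : ℕ → ℕ → ℝ} (h : ∀ a b, 0 ≤ u a b) : 0 ≤ biradialExp α β p q k u := by
  have := biradialExp_mono hα hβ hp hq k (u := fun a b => 0 * u a b) (v := u)
    (fun a b => by simpa using h a b)
  rwa [biradialExp_smul, zero_mul] at this

lemma biradialExp_le_of_superharmonic (hα : 0 < α) (hβ : 0 < β) (hp : 1 < p) (hq : 1 < q)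
    {l : ℝ} (hl : 0 ≤ l) {h : ℕ → ℕ → ℝ}
    (hs : ∀ a b, biradialOp α β p q h a b ≤ l * h a b) (k : ℕ) :
    biradialExp α β p q k h ≤ l ^ k * h 0 0 := by
  induction k with
  | zero => simp [biradialExp_zero]
  | succ k ih =>
    rw [biradialExp_succ]
    refine (biradialExp_mono hα hβ hp hq k hs).trans ?_
    rw [biradialExp_smul, pow_succ']
    nlinarith [mul_le_mul_of_nonneg_left ih hl]

lemma le_biradialExp_of_subharmonic (hα : 0 < α) (hβ : 0 < β) (hp : 1 < p) (hq : 1 < q)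
    {l : ℝ} (hl : 0 ≤ l) {h : ℕ → ℕ → ℝ}
    (hs : ∀ a b, l * h a b ≤ biradialOp α β p q h a b) (k : ℕ) :
    l ^ k * h 0 0 ≤ biradialExp α β p q k h := by
  induction k with
  | zero => simp [biradialExp_zero]
  | succ k ih =>
    rw [biradialExp_succ]
    refine le_trans ?_ (biradialExp_mono hα hβ hp hq k hs)
    rw [biradialExp_smul, pow_succ']
    nlinarith [mul_le_mul_of_nonneg_left ih hl]

lemma summable_biradialExp_mono (hα : 0 < α) (hβ : 0 < β) (hp : 1 < p) (hq : 1 < q)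
    {r : ℝ} (hr : 0 < r) {u v : ℕ → ℕ → ℝ} (hu : ∀ a b, 0 ≤ u a b) {C : ℝ}
    (huv : ∀ a b, u a b ≤ C * v a b)
    (hv : Summable fun k => r ^ k * biradialExp α β p q k v) :
    Summable fun k => r ^ k * biradialExp α β p q k u := by
  refine Summable.of_nonneg_of_le
    (fun k => mul_nonneg (by positivity) (biradialExp_nonneg hα hβ hp hq k hu))
    (fun k => ?_) (hv.mul_left C)
  have := biradialExp_mono hα hβ hp hq k huv
  rw [biradialExp_smul] at this
  have := mul_le_mul_of_nonneg_left this (by positivity : 0 ≤ r ^ k)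
  linarith

lemma summable_of_superharmonic (hα : 0 < α) (hβ : 0 < β) (hp : 1 < p) (hq : 1 < q)
    {r l : ℝ} (hr : 0 < r) (hl : 0 ≤ l) (hrl : r * l < 1) {h : ℕ → ℕ → ℝ}
    (hh : ∀ a b, 0 ≤ h a b) (hs : ∀ a b, biradialOp α β p q h a b ≤ l * h a b) :
    Summable fun k => r ^ k * biradialExp α β p q k h := by
  refine Summable.of_nonneg_of_le
    (fun k => mul_nonneg (by positivity) (biradialExp_nonneg hα hβ hp hq k hh)) (fun k => ?_)
    ((summable_geometric_of_lt_one (by positivity) hrl).mul_right (h 0 0))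
  have := biradialExp_le_of_superharmonic hα hβ hp hq hl hs k
  have := mul_le_mul_of_nonneg_left this (by positivity : 0 ≤ r ^ k)
  rw [mul_pow]; linarith

lemma not_summable_of_subharmonic (hα : 0 < α) (hβ : 0 < β) (hp : 1 < p) (hq : 1 < q)
    {r l : ℝ} (hr : 0 < r) (hl : 0 ≤ l) (hrl : 1 ≤ r * l) {h : ℕ → ℕ → ℝ}
    (hh : 0 < h 0 0) (hs : ∀ a b, l * h a b ≤ biradialOp α β p q h a b) :
    ¬ Summable fun k => r ^ k * biradialExp α β p q k h := by
  intro hsum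
  have h0 := hsum.tendsto_atTop_zero
  have : ∀ k : ℕ, h 0 0 ≤ r ^ k * biradialExp α β p q k h := fun k => by
    have h1 := le_biradialExp_of_subharmonic hα hβ hp hq hl hs k
    have h2 := mul_le_mul_of_nonneg_left h1 (by positivity : 0 ≤ r ^ k)
    have h3 : 1 ≤ (r * l) ^ k := one_le_pow₀ hrl
    rw [mul_pow] at h3
    nlinarith
  exact absurd (ge_of_tendsto' h0 this) (by linarith)

lemma biradialExp_telescope (r : ℝ) (h : ℕ → ℕ → ℝ) (K : ℕ) :
    ∑ k ∈ Finset.range K, r ^ k *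
        biradialExp α β p q k (fun a b => h a b - r * biradialOp α β p q h a b) =
      h 0 0 - r ^ K * biradialExp α β p q K h := by
  induction K with
  | zero => simp [biradialExp_zero]
  | succ K ih =>
    rw [Finset.sum_range_succ, ih]
    have e := biradialExp_linear α β p q K 1 (-r) h (biradialOp α β p q h)
    have e' : (fun a b => 1 * h a b + -r * biradialOp α β p q h a b) =
        fun a b => h a b - r * biradialOp α β p q h a b := by funext a b; ring
    rw [e'] at e
    rw [e, biradialExp_succ]; ring

lemma summable_of_potential (hα : 0 < α) (hβ : 0 < β) (hp : 1 < p) (hq : 1 < q)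
    {r : ℝ} (hr : 0 < r) {h w : ℕ → ℕ → ℝ} (hh : ∀ a b, 0 ≤ h a b) (hw : ∀ a b, 0 ≤ w a b)
    (hs : ∀ a b, w a b ≤ h a b - r * biradialOp α β p q h a b) :
    Summable fun k => r ^ k * biradialExp α β p q k w := by
  refine summable_of_sum_range_le (c := h 0 0)
    (fun k => mul_nonneg (by positivity) (biradialExp_nonneg hα hβ hp hq k hw)) (fun K => ?_)
  calc _ ≤ ∑ k ∈ Finset.range K, r ^ k *
        biradialExp α β p q k (fun a b => h a b - r * biradialOp α β p q h a b) :=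
        Finset.sum_le_sum fun k _ => mul_le_mul_of_nonneg_left
          (biradialExp_mono hα hβ hp hq k hs) (by positivity)
    _ = h 0 0 - r ^ K * biradialExp α β p q K h := biradialExp_telescope r h K
    _ ≤ h 0 0 := by
        have := biradialExp_nonneg hα hβ hp hq K hh
        have : 0 ≤ r ^ K * biradialExp α β p q K h := by positivity
        linarith

lemma le_tsum_of_potential (hα : 0 < α) (hβ : 0 < β) (hp : 1 < p) (hq : 1 < q)
    {r : ℝ} (hr : 0 < r) {h w : ℕ → ℕ → ℝ} {M : ℝ} (hh : ∀ a b, h a b ≤ M * w a b)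
    (hs : ∀ a b, h a b - r * biradialOp α β p q h a b ≤ w a b)
    (hsum : Summable fun k => r ^ k * biradialExp α β p q k w) :
    h 0 0 ≤ ∑' k, r ^ k * biradialExp α β p q k w := by
  have h1 : ∀ K : ℕ, h 0 0 ≤ ∑ k ∈ Finset.range K, r ^ k * biradialExp α β p q k w +
      M * (r ^ K * biradialExp α β p q K w) := fun K => by
    have e := biradialExp_telescope (α := α) (β := β) (p := p) (q := q) r h K
    have e1 : ∑ k ∈ Finset.range K, r ^ k *
        biradialExp α β p q k (fun a b => h a b - r * biradialOp α β p q h a b) ≤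
        ∑ k ∈ Finset.range K, r ^ k * biradialExp α β p q k w :=
      Finset.sum_le_sum fun k _ => mul_le_mul_of_nonneg_left
          (biradialExp_mono hα hβ hp hq k hs) (by positivity)
    have e2 := biradialExp_mono hα hβ hp hq K hh
    rw [biradialExp_smul] at e2
    have e3 := mul_le_mul_of_nonneg_left e2 (by positivity : 0 ≤ r ^ K)
    linarith
  have h2 := hsum.hasSum.tendsto_sum_nat.add (hsum.tendsto_atTop_zero.const_mul M)
  rw [mul_zero, add_zero] at h2
  exact ge_of_tendsto' h2 h1

lemma biradialOp_nonneg (hα : 0 < α) (hβ : 0 < β) (hp : 1 < p) (hq : 1 < q)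
    {u : ℕ → ℕ → ℝ} (h : ∀ a b, 0 ≤ u a b) (a b : ℕ) : 0 ≤ biradialOp α β p q u a b := by
  have := biradialOp_mono hα hβ hp hq (u := fun a b => 0 * u a b + 0 * u a b) (v := u)
    (fun a b => by simpa using h a b) a b
  rw [biradialOp_linear] at this
  simpa using this

lemma tensor_superharmonic (hα : 0 < α) (hβ : 0 < β) {f g : ℕ → ℝ} {x y : ℝ}
    (hf0 : ∀ n, 0 ≤ f n) (hg0 : ∀ n, 0 ≤ g n) (hf : ∀ n, radialOp p f n ≤ x * f n)
    (hg : ∀ n, radialOp q g n ≤ y * g n) (a b : ℕ) :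
    biradialOp α β p q (tensor f g) a b ≤ (α * x + β * y) * tensor f g a b := by
  rw [biradialOp_tensor]
  have h1 := mul_le_mul_of_nonneg_left (hf a) (mul_nonneg hα.le (hg0 b))
  have h2 := mul_le_mul_of_nonneg_left (hg b) (mul_nonneg hβ.le (hf0 a))
  unfold tensor; linarith

lemma tensor_subharmonic (hα : 0 < α) (hβ : 0 < β) {f g : ℕ → ℝ} {x y : ℝ}
    (hf0 : ∀ n, 0 ≤ f n) (hg0 : ∀ n, 0 ≤ g n) (hf : ∀ n, x * f n ≤ radialOp p f n)
    (hg : ∀ n, y * g n ≤ radialOp q g n) (a b : ℕ) :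
    (α * x + β * y) * tensor f g a b ≤ biradialOp α β p q (tensor f g) a b := by
  rw [biradialOp_tensor]
  have h1 := mul_le_mul_of_nonneg_left (hf a) (mul_nonneg hα.le (hg0 b))
  have h2 := mul_le_mul_of_nonneg_left (hg b) (mul_nonneg hβ.le (hf0 a))
  unfold tensor; linarith

end Positive

/-! ### Critical exponents of the product -/

/-- A finitely supported function is dominated by a multiple of any positive one. -/
lemma exists_le_mul_of_finite_support {h v : ℕ → ℝ} {N : ℕ} (hv : ∀ n, 0 < v n)
    (hh : ∀ n, 0 ≤ h n) (hN : ∀ n, N ≤ n → h n = 0) :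
    ∃ C : ℝ, 0 ≤ C ∧ ∀ n, h n ≤ C * v n := by
  have hnn : ∀ n, 0 ≤ h n / v n := fun n => div_nonneg (hh n) (hv n).le
  refine ⟨∑ n ∈ Finset.range N, h n / v n, Finset.sum_nonneg fun n _ => hnn n, fun n => ?_⟩
  rcases lt_or_ge n N with hn | hn
  · have := Finset.single_le_sum (f := fun n => h n / v n) (fun n _ => hnn n)
      (Finset.mem_range.2 hn)
    rwa [← div_le_iff₀ (hv n)]
  · rw [hN n hn]
    exact mul_nonneg (Finset.sum_nonneg fun n _ => hnn n) (hv n).le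

section Critical

variable {α β p q r t t' : ℝ}

lemma summable_powWeight_of_lt (hα : 0 < α) (hβ : 0 < β) (hp : 1 < p) (hpq : p < q)
    (hr : 0 < r) (ht : critRatio p ≤ t)
    (hrt : r * (α * treeEigenvalue p t + β * treeEigenvalue q t) = 1)
    (ht0 : 0 < t') (htt : t' < t) :
    Summable fun k => r ^ k * biradialExp α β p q k (powWeight t') := by
  have hq : 1 < q := hp.trans hpq
  have hc := critRatio_anti hp hpq
  have hcp := critRatio_pos hp
  obtain ⟨s, hs1, hs2⟩ := exists_between (max_lt htt (hc.trans_le ht))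
  have hst : t' < s := (le_max_left _ _).trans_lt hs1
  have hsq : critRatio q < s := (le_max_right _ _).trans_lt hs1
  set τ := max s (critRatio p) with hτ
  have hτt : τ ≤ t := max_le hs2.le ht
  obtain ⟨f, a, ha, hf, haf⟩ := exists_superharmonic hp (le_max_right s (critRatio p))
  obtain ⟨g, b, hb, hg, hbg⟩ := exists_superharmonic hq hsq.le
  have hs0 : 0 < s := ht0.trans hst
  have hτ0 : 0 < τ := lt_max_of_lt_left hs0
  have hf0 : ∀ n, 0 ≤ f n := fun n => le_trans (by positivity) (haf n)
  have hg0 : ∀ n, 0 ≤ g n := fun n => le_trans (by positivity) (hbg n)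
  have e1 := treeEigenvalue_le hp (le_max_right s (critRatio p)) hτt
  have e2 := treeEigenvalue_lt hq hsq.le hs2
  have e3 := treeEigenvalue_pos hp hτ0
  have e4 := treeEigenvalue_pos hq hs0
  have hlt : α * treeEigenvalue p τ + β * treeEigenvalue q s <
      α * treeEigenvalue p t + β * treeEigenvalue q t := by nlinarith
  have hsum := summable_of_superharmonic hα hβ hp hq hr (by positivity)
    (by rw [← hrt]; exact mul_lt_mul_of_pos_left hlt hr)
    (fun a b => mul_nonneg (hf0 a) (hg0 b)) (tensor_superharmonic hα hβ hf0 hg0 hf hg)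
  refine summable_biradialExp_mono hα hβ hp hq hr (fun i j => (powWeight_pos ht0 i j).le)
    (C := (a * b)⁻¹) (fun i j => ?_) hsum
  rw [← div_eq_inv_mul, le_div_iff₀ (by positivity)]
  have h1 : a * t' ^ i ≤ f i := by
    refine le_trans ?_ (haf i)
    have : t' ≤ τ := hst.le.trans (le_max_left _ _)
    gcongr
  have h2 : b * t' ^ j ≤ g j := by
    refine le_trans ?_ (hbg j)
    gcongr
  have := mul_le_mul h1 h2 (by positivity) (hf0 i)
  unfold powWeight tensor
  linarith

lemma not_summable_powWeight_of_supercritical (hα : 0 < α) (hβ : 0 < β) (hp : 1 < p)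
    (hpq : p < q) (hr : 0 < r) (ht : critRatio p ≤ t)
    (hrt : r * (α * treeEigenvalue p t + β * treeEigenvalue q t) = 1) :
    ¬ Summable fun k => r ^ k * biradialExp α β p q k (powWeight t) := by
  have hq : 1 < q := hp.trans hpq
  have hc := critRatio_anti hp hpq
  have hcp := critRatio_pos hp
  have ht0 : 0 < t := hcp.trans_le ht
  have htq : critRatio q < t := hc.trans_le ht
  have e3 := treeEigenvalue_pos hp ht0
  have e4 := treeEigenvalue_pos hq ht0
  obtain ⟨g, b, B, hb, hB, hg, hbg, hgB⟩ := exists_spherical hq htq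
  have hg0 : ∀ n, 0 < g n := fun n => lt_of_lt_of_le (by positivity) (hbg n)
  rcases ht.eq_or_lt with rfl | htp
  · intro hsum
    obtain ⟨C, hC0, hC⟩ := exists_critical_growth hp
    set S := ∑' k, r ^ k * biradialExp α β p q k (powWeight (critRatio p)) with hS
    have key : ∀ N : ℝ, 0 ≤ N → N * g 0 ≤ r * α * (C + 1) * B * S := by
      intro N hN
      obtain ⟨f, M, hf0, hM0, hfM, hf⟩ := hC N hN
      set D := r * α * (C + 1) * B with hD
      have hD0 : 0 < D := by positivity
      have := le_tsum_of_potential hα hβ hp hq hr (h := tensor f g)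
        (w := fun i j => D * powWeight (critRatio p) i j) (M := M * B / D)
        (fun i j => ?_) (fun i j => ?_) ?_
      · simp only [tensor, hf0, biradialExp_smul] at this
        refine this.trans_eq ?_
        rw [hS, ← tsum_mul_left]
        exact tsum_congr fun k => by ring
      · have h1 := mul_le_mul (hfM i) (hgB j) (hg0 j).le (by positivity)
        have : M * B / D * (D * powWeight (critRatio p) i j) =
            M * critRatio p ^ i * (B * critRatio p ^ j) := by
          unfold powWeight tensor; field_simp
        rw [this]; exact h1
      · rw [biradialOp_tensor, hg j]
        have h1 : tensor f g i j - r * (α * radialOp p f i * g j +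
            β * f i * (treeEigenvalue q (critRatio p) * g j)) =
            r * α * (treeEigenvalue p (critRatio p) * f i - radialOp p f i) * g j := by
          unfold tensor; linear_combination - f i * g j * hrt
        rw [h1]
        have h2 : treeEigenvalue p (critRatio p) * f i - radialOp p f i ≤
            (C + 1) * critRatio p ^ i := by
          refine (hf i).trans ?_
          gcongr; linarith
        calc _ ≤ r * α * ((C + 1) * critRatio p ^ i) * g j :=
              mul_le_mul_of_nonneg_right
                (mul_le_mul_of_nonneg_left h2 (by positivity)) (hg0 j).le
          _ ≤ r * α * ((C + 1) * critRatio p ^ i) * (B * critRatio p ^ j) :=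
              mul_le_mul_of_nonneg_left (hgB j) (by positivity)
          _ = _ := by rw [hD]; unfold powWeight tensor; ring
      · simp only [biradialExp_smul]
        exact (hsum.mul_left D).congr fun k => by ring
    have h1 := key (|r * α * (C + 1) * B * S| / g 0 + 1)
      (by have := hg0 0; positivity)
    have h2 : (|r * α * (C + 1) * B * S| / g 0 + 1) * g 0 =
        |r * α * (C + 1) * B * S| + g 0 := by
      have := (hg0 0).ne'; field_simp
    linarith [le_abs_self (r * α * (C + 1) * B * S), hg0 0]
  · obtain ⟨f, a, A, ha, hA, hf, haf, hfA⟩ := exists_spherical hp htp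
    have hf0 : ∀ n, 0 < f n := fun n => lt_of_lt_of_le (by positivity) (haf n)
    intro hsum
    refine not_summable_of_subharmonic hα hβ hp hq hr (by positivity) hrt.ge
      (mul_pos (hf0 0) (hg0 0)) (tensor_subharmonic hα hβ (fun n => (hf0 n).le)
        (fun n => (hg0 n).le) (fun n => (hf n).ge) fun n => (hg n).ge)
      (summable_biradialExp_mono hα hβ hp hq hr
        (fun i j => (mul_pos (hf0 i) (hg0 j)).le) (C := A * B) (fun i j => ?_) hsum)
    refine (mul_le_mul (hfA i) (hgB j) (hg0 j).le (by positivity)).trans_eq ?_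
    unfold powWeight tensor; ring

lemma summable_powWeight_of_intermediate (hα : 0 < α) (hβ : 0 < β) (hp : 1 < p)
    (hpq : p < q) (hr : 0 < r) (htq : critRatio q < t) (htp : t < critRatio p)
    (hrt : r * (α * treeEigenvalue p (critRatio p) + β * treeEigenvalue q t) = 1) :
    Summable fun k => r ^ k * biradialExp α β p q k (powWeight t) := by
  have hq : 1 < q := hp.trans hpq
  have ht0 : 0 < t := (critRatio_pos hq).trans htq
  obtain ⟨g, b, B, hb, hB, hg, hbg, hgB⟩ := exists_spherical hq htq
  obtain ⟨f, hf0, hf⟩ := exists_subcritical_potential hp ht0 htp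
  have hg0 : ∀ n, 0 < g n := fun n => lt_of_lt_of_le (by positivity) (hbg n)
  have hsum : Summable fun k => r ^ k * biradialExp α β p q k
      (fun i j => r * α * b * powWeight t i j) := by
    refine summable_of_potential hα hβ hp hq hr (h := tensor f g)
      (fun i j => mul_nonneg (hf0 i) (hg0 j).le) (fun i j => ?_) (fun i j => ?_)
    · have := powWeight_pos ht0 i j; positivity
    · rw [biradialOp_tensor, hg j]
      have h1 : tensor f g i j - r * (α * radialOp p f i * g j +
          β * f i * (treeEigenvalue q t * g j)) =
          r * α * ((treeEigenvalue p (critRatio p) * f i - radialOp p f i) * g j) := by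
        unfold tensor; linear_combination - f i * g j * hrt
      rw [h1]
      have h2 := mul_le_mul (hf i) (hbg j) (by positivity) (le_trans (by positivity) (hf i))
      have := mul_le_mul_of_nonneg_left h2 (by positivity : 0 ≤ r * α)
      unfold powWeight tensor; linarith
  refine summable_biradialExp_mono hα hβ hp hq hr (fun i j => (powWeight_pos ht0 i j).le)
    (C := (r * α * b)⁻¹) (fun i j => ?_) hsum
  field_simp
  exact le_rfl

lemma not_summable_powWeight_of_intermediate (hα : 0 < α) (hβ : 0 < β) (hp : 1 < p)
    (hpq : p < q) (hr : 0 < r) (htq : critRatio q < t)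
    (hrt : r * (α * treeEigenvalue p (critRatio p) + β * treeEigenvalue q t) = 1)
    (htt : t < t') :
    ¬ Summable fun k => r ^ k * biradialExp α β p q k (powWeight t') := by
  have hq : 1 < q := hp.trans hpq
  have ht0 : 0 < t := (critRatio_pos hq).trans htq
  have ht0' : 0 < t' := ht0.trans htt
  obtain ⟨g, b, B, hb, hB, hg, hbg, hgB⟩ := exists_spherical hq (htq.trans htt)
  have hg0 : ∀ n, 0 < g n := fun n => lt_of_lt_of_le (by positivity) (hbg n)
  have e1 := treeEigenvalue_lt hq htq.le htt
  have e2 := treeEigenvalue_pos hq ht0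
  have e3 := treeEigenvalue_pos hp (critRatio_pos hp)
  set ε := β * (treeEigenvalue q t' - treeEigenvalue q t) / α with hε
  have hε0 : 0 < ε := div_pos (mul_pos hβ (by linarith)) hα
  have hεα : α * ε = β * (treeEigenvalue q t' - treeEigenvalue q t) := by
    rw [hε]; field_simp
  obtain ⟨f, N, hf0, hf00, hfN, hf⟩ := exists_finite_subharmonic hp hε0
  obtain ⟨C, hC0, hC⟩ := exists_le_mul_of_finite_support (v := fun n => t' ^ n)
    (fun n => by positivity) hf0 hfN
  have hl : α * (treeEigenvalue p (critRatio p) - ε) + β * treeEigenvalue q t' =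
      α * treeEigenvalue p (critRatio p) + β * treeEigenvalue q t := by
    linear_combination -hεα
  intro hsum
  refine not_summable_of_subharmonic hα hβ hp hq hr (h := tensor f g)
    (l := α * (treeEigenvalue p (critRatio p) - ε) + β * treeEigenvalue q t')
    (by rw [hl]; positivity) (by rw [hl, hrt])
    (mul_pos hf00 (hg0 0)) (tensor_subharmonic hα hβ hf0
      (fun n => (hg0 n).le) hf fun n => (hg n).ge)
    (summable_biradialExp_mono hα hβ hp hq hr
      (fun i j => mul_nonneg (hf0 i) (hg0 j).le) (C := C * B) (fun i j => ?_) hsum)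
  refine (mul_le_mul (hC i) (hgB j) (hg0 j).le (by positivity)).trans_eq ?_
  unfold powWeight tensor; ring

end Critical

/-! ### Return probabilities -/

/-- The indicator function of the root. -/
def rootIndicator (a b : ℕ) : ℝ := if a = 0 ∧ b = 0 then 1 else 0

lemma rootIndicator_nonneg (a b : ℕ) : 0 ≤ rootIndicator a b := by
  unfold rootIndicator; split_ifs <;> norm_num

section Return

variable {α β p q : ℝ}

lemma biradialExp_root_le (hα : 0 < α) (hβ : 0 < β) (hp : 1 < p) (hq : 1 < q) (k : ℕ) :
    biradialExp α β p q k rootIndicator ≤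
      (α * treeEigenvalue p (critRatio p) + β * treeEigenvalue q (critRatio q)) ^ k := by
  have h1 := critRatio_pos hp
  have h2 := critRatio_pos hq
  have e3 := treeEigenvalue_pos hp h1
  have e4 := treeEigenvalue_pos hq h2
  have h := biradialExp_le_of_superharmonic hα hβ hp hq (by positivity)
    (tensor_superharmonic hα hβ (fun n => by positivity) (fun n => by positivity)
      (critical_superharmonic hp) (critical_superharmonic hq)) k
  simp only [tensor, pow_zero, mul_one] at h
  refine le_trans (biradialExp_mono hα hβ hp hq k fun a b => ?_) h
  unfold rootIndicator tensor
  split_ifs with hab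
  · simp [hab.1, hab.2]
  · positivity

/-- A lower bound for all the one-step transition weights. -/
lemma exists_transition_bound (hα : 0 < α) (hβ : 0 < β) (hαβ : α + β = 1) (hp : 1 < p)
    (hq : 1 < q) : ∃ c : ℝ, 0 < c ∧ ∀ w : ℕ → ℕ → ℝ, (∀ a b, 0 ≤ w a b) → ∀ a b,
      c * w a b ≤ biradialOp α β p q w a b ∧
      c * w a b ≤ biradialOp α β p q w (a + 1) b ∧
      c * w a b ≤ biradialOp α β p q w a (b + 1) ∧
      c * w (a + 1) b ≤ biradialOp α β p q w a b := by
  have hdiag : ∀ {q : ℝ}, 1 < q → ∀ u : ℕ → ℝ, (∀ n, 0 ≤ u n) → ∀ n,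
      u n / 2 ≤ radialOp q u n ∧ (2 * (q + 1))⁻¹ * u n ≤ radialOp q u (n + 1) ∧
        (2 * (q + 1))⁻¹ * u (n + 1) ≤ radialOp q u n := by
    intro q hq u hu n
    have hq0 : 0 < q := by linarith
    refine ⟨?_, ?_, ?_⟩
    · cases n with
      | zero => rw [radialOp_zero]; linarith [hu 1]
      | succ n =>
        rw [radialOp_succ]
        have := hu n
        have := hu (n + 2)
        have : 0 ≤ (u n + q * u (n + 2)) / (2 * (q + 1)) := by positivity
        linarith
    · rw [radialOp_succ, add_div, div_eq_inv_mul (u n)]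
      have := hu (n + 1)
      have := hu (n + 2)
      have : 0 ≤ q * u (n + 2) / (2 * (q + 1)) := by positivity
      linarith
    · have h2 : (2 * (q + 1))⁻¹ * u (n + 1) ≤ u (n + 1) / 2 := by
        rw [← div_eq_inv_mul]
        apply div_le_div_of_nonneg_left (hu _) <;> linarith
      cases n with
      | zero => rw [radialOp_zero]; rw [zero_add] at h2 ⊢; linarith [hu 0]
      | succ n =>
        rw [radialOp_succ, add_div]
        have := hu n
        have := hu (n + 1)
        have h3 := hu (n + 2)
        have : 0 ≤ u n / (2 * (q + 1)) := by positivity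
        have : (2 * (q + 1))⁻¹ * u (n + 2) ≤ q * u (n + 2) / (2 * (q + 1)) := by
          rw [div_eq_inv_mul]
          gcongr; nlinarith
        show (2 * (q + 1))⁻¹ * u (n + 2) ≤ _
        linarith
  have hp0 : 0 < p := by linarith
  have hq0 : 0 < q := by linarith
  set c := min (1 / 2) (min (α * (2 * (p + 1))⁻¹) (β * (2 * (q + 1))⁻¹)) with hc
  have hc1 : c ≤ 1 / 2 := min_le_left _ _
  have hc2 : c ≤ α * (2 * (p + 1))⁻¹ := (min_le_right _ _).trans (min_le_left _ _)
  have hc3 : c ≤ β * (2 * (q + 1))⁻¹ := (min_le_right _ _).trans (min_le_right _ _)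
  refine ⟨c, lt_min (by norm_num) (lt_min (by positivity) (by positivity)), fun w hw a b => ?_⟩
  have hnn : ∀ a b, 0 ≤ radialOp p (fun i => w i b) a ∧ 0 ≤ radialOp q (w a) b := fun a b =>
    ⟨(by linarith [hw a b] : 0 ≤ w a b / 2).trans (hdiag hp (fun i => w i b) (fun i => hw i b) a).1,
      (by linarith [hw a b] : 0 ≤ w a b / 2).trans (hdiag hq (w a) (hw a) b).1⟩
  obtain ⟨x1, x2, x3⟩ := hdiag hp (fun i => w i b) (fun i => hw i b) a
  obtain ⟨y1, y2, y3⟩ := hdiag hq (w a) (hw a) b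
  have hw0 := hw a b
  unfold biradialOp
  refine ⟨?_, ?_, ?_, ?_⟩
  · have := mul_le_mul_of_nonneg_right hc1 hw0
    have := mul_le_mul_of_nonneg_left x1 hα.le
    have := mul_le_mul_of_nonneg_left y1 hβ.le
    have : w a b = α * w a b + β * w a b := by rw [← add_mul, hαβ, one_mul]
    linarith
  · have := mul_le_mul_of_nonneg_right hc2 hw0
    have := mul_le_mul_of_nonneg_left x2 hα.le
    have := mul_nonneg hβ.le (hnn (a + 1) b).2
    linarith
  · have := mul_le_mul_of_nonneg_right hc3 hw0
    have := mul_le_mul_of_nonneg_left y2 hβ.le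
    have := mul_nonneg hα.le (hnn a (b + 1)).1
    linarith
  · have := mul_le_mul_of_nonneg_right hc2 (hw (a + 1) b)
    have := mul_le_mul_of_nonneg_left x3 hα.le
    have := mul_nonneg hβ.le (hnn a b).2
    linarith

lemma exists_pow_le_biradialExp_sphere (hα : 0 < α) (hβ : 0 < β) (hαβ : α + β = 1)
    (hp : 1 < p) (hq : 1 < q) : ∃ c : ℝ, 0 < c ∧ ∀ k : ℕ,
      c ^ k ≤ biradialExp α β p q k (fun a b => if a + b = k then 1 else 0) := by
  obtain ⟨c, hc, h⟩ := exists_transition_bound hα hβ hαβ hp hq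
  refine ⟨c, hc, fun k => ?_⟩
  have key : ∀ (k : ℕ) (w : ℕ → ℕ → ℝ), (∀ a b, 0 ≤ w a b) → ∀ a,
      c ^ k * w (a + k) 0 ≤ (biradialOp α β p q)^[k] w a 0 := by
    intro k
    induction k with
    | zero => intro w _ a; simp
    | succ k ih =>
      intro w hw a
      rw [Function.iterate_succ_apply]
      refine le_trans ?_ (ih _ (biradialOp_nonneg hα hβ hp hq hw) a)
      have := mul_le_mul_of_nonneg_left (h w hw (a + k) 0).2.2.2 (by positivity : 0 ≤ c ^ k)
      rw [pow_succ, ← add_assoc]; linarith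
  have := key k (fun a b => if a + b = k then 1 else 0)
    (fun a b => by split_ifs <;> norm_num) 0
  simpa [biradialExp] using this

lemma exists_le_biradialExp_root (hα : 0 < α) (hβ : 0 < β) (hαβ : α + β = 1) (hp : 1 < p)
    (hq : 1 < q) {l : ℝ} (hl0 : 0 ≤ l)
    (hl : l < α * treeEigenvalue p (critRatio p) + β * treeEigenvalue q (critRatio q)) :
    ∃ (c : ℝ) (M : ℕ), 0 < c ∧ ∀ k : ℕ,
      c * l ^ k ≤ biradialExp α β p q (k + M) rootIndicator := by
  obtain ⟨c, hc, hstep⟩ := exists_transition_bound hα hβ hαβ hp hq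
  set ε := α * treeEigenvalue p (critRatio p) + β * treeEigenvalue q (critRatio q) - l with hε
  have hε0 : 0 < ε := by linarith
  obtain ⟨f, N, hf0, hf00, hfN, hf⟩ := exists_finite_subharmonic hp hε0
  obtain ⟨g, N', hg0, hg00, hgN, hg⟩ := exists_finite_subharmonic hq hε0
  have hnn : ∀ k a b, 0 ≤ (biradialOp α β p q)^[k] rootIndicator a b := by
    intro k
    induction k with
    | zero => exact rootIndicator_nonneg
    | succ k ih =>
      rw [Function.iterate_succ_apply']
      exact biradialOp_nonneg hα hβ hp hq ih
  have hle : ∀ k a b, a + b ≤ k → c ^ k ≤ (biradialOp α β p q)^[k] rootIndicator a b := by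
    intro k
    induction k with
    | zero =>
      intro a b hab
      have : a = 0 ∧ b = 0 := by omega
      simp [rootIndicator, this]
    | succ k ih =>
      intro a b hab
      rw [Function.iterate_succ_apply', pow_succ']
      rcases a with _ | a
      · rcases b with _ | b
        · exact (mul_le_mul_of_nonneg_left (ih 0 0 (by omega)) hc.le).trans
            (hstep _ (hnn k) 0 0).1
        · exact (mul_le_mul_of_nonneg_left (ih 0 b (by omega)) hc.le).trans
            (hstep _ (hnn k) 0 b).2.2.1
      · exact (mul_le_mul_of_nonneg_left (ih a b (by omega)) hc.le).trans
          (hstep _ (hnn k) a b).2.1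
  obtain ⟨A, hA0, hA⟩ := exists_le_mul_of_finite_support (v := fun _ => 1)
    (fun _ => one_pos) hf0 hfN
  obtain ⟨B, hB0, hB⟩ := exists_le_mul_of_finite_support (v := fun _ => 1)
    (fun _ => one_pos) hg0 hgN
  simp only [mul_one] at hA hB
  have hA1 : 0 < A := hf00.trans_le (hA 0)
  have hB1 : 0 < B := hg00.trans_le (hB 0)
  set D := A * B / c ^ (N + N') with hD
  have hD0 : 0 < D := by positivity
  have hdom : ∀ a b, tensor f g a b ≤ D * (biradialOp α β p q)^[N + N'] rootIndicator a b := by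
    intro a b
    unfold tensor
    rcases lt_or_ge a N with ha | ha
    · rcases lt_or_ge b N' with hb | hb
      · have h1 := hle (N + N') a b (by omega)
        have h2 : D * c ^ (N + N') = A * B := by rw [hD]; field_simp
        calc f a * g b ≤ A * B := mul_le_mul (hA a) (hB b) (hg0 b) hA0
          _ = D * c ^ (N + N') := h2.symm
          _ ≤ _ := mul_le_mul_of_nonneg_left h1 hD0.le
      · rw [hgN b hb, mul_zero]; exact mul_nonneg hD0.le (hnn _ a b)
    · rw [hfN a ha, zero_mul]; exact mul_nonneg hD0.le (hnn _ a b)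
  refine ⟨f 0 * g 0 / D, N + N', by positivity, fun k => ?_⟩
  have hsub : ∀ a b, l * tensor f g a b ≤ biradialOp α β p q (tensor f g) a b := by
    have := tensor_subharmonic (p := p) (q := q) hα hβ hf0 hg0 hf hg
    have e : α * (treeEigenvalue p (critRatio p) - ε) + β * (treeEigenvalue q (critRatio q) - ε)
        = l := by linear_combination -ε * hαβ - hε
    rwa [e] at this
  have h1 := le_biradialExp_of_subharmonic hα hβ hp hq hl0 hsub k
  have h2 := biradialExp_mono hα hβ hp hq k hdom
  rw [biradialExp_smul, ← biradialExp_add] at h2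
  have h3 := h1.trans h2
  rw [div_mul_eq_mul_div, div_le_iff₀ hD0]
  unfold tensor at h3
  linarith

end Return

/-- The radial data of the phase transition: existence of the critical radius and of the
critical ratio at each radius. -/
lemma exists_radial_phase_transition {α β p q : ℝ} (hα : 0 < α) (hβ : 0 < β)
    (hαβ : α + β = 1) (hp : 1 < p) (hq : 1 < q) (hpq : p ≠ q) :
    ∃ r₀ : ℝ, 1 < r₀ ∧
      r₀ < (α * treeEigenvalue p (critRatio p) + β * treeEigenvalue q (critRatio q))⁻¹ ∧
      (∀ r, 0 < r → r ≤ r₀ → ∃ t, 0 < t ∧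
        (¬ Summable fun k => r ^ k * biradialExp α β p q k (powWeight t)) ∧
        ∀ t', 0 < t' → t' < t →
          Summable fun k => r ^ k * biradialExp α β p q k (powWeight t')) ∧
      (∀ r, r₀ < r →
        r < (α * treeEigenvalue p (critRatio p) + β * treeEigenvalue q (critRatio q))⁻¹ →
        ∃ t, 0 < t ∧ (Summable fun k => r ^ k * biradialExp α β p q k (powWeight t)) ∧
        ∀ t', t < t' → ¬ Summable fun k => r ^ k * biradialExp α β p q k (powWeight t')) := by
  wlog hlt : p < q generalizing α β p q
  · have hqp : q < p := lt_of_le_of_ne (not_lt.1 hlt) hpq.symm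
    have := this hβ hα (by linarith) hq hp hpq.symm hqp
    have e : ∀ (k : ℕ) (t : ℝ), biradialExp α β p q k (powWeight t) =
        biradialExp β α q p k (powWeight t) := fun k t => by
      rw [biradialExp_swap, powWeight_swap]
    simp only [e]
    rwa [add_comm (α * _)]
  have hc := critRatio_anti hp hlt
  have hcp := critRatio_pos hp
  have hcq := critRatio_pos hq
  have e1 := treeEigenvalue_pos hp hcp
  have e2 := treeEigenvalue_pos hq hcp
  have e3 := treeEigenvalue_pos hq hcq
  have e4 := treeEigenvalue_lt hq le_rfl hc
  set ρ := α * treeEigenvalue p (critRatio p) + β * treeEigenvalue q (critRatio q) with hρ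
  set v := α * treeEigenvalue p (critRatio p) + β * treeEigenvalue q (critRatio p) with hv
  have hρ0 : 0 < ρ := by positivity
  have hv0 : 0 < v := by positivity
  have hv1 : v < 1 := by
    have h1 := treeEigenvalue_lt hp le_rfl (critRatio_lt_one hp)
    have h2 := treeEigenvalue_lt hq hc.le (critRatio_lt_one hp)
    rw [treeEigenvalue_one hp] at h1
    rw [treeEigenvalue_one hq] at h2
    rw [hv, ← hαβ]; nlinarith
  have hρv : ρ < v := by
    have := mul_lt_mul_of_pos_left e4 hβ
    linarith
  refine ⟨v⁻¹, (one_lt_inv₀ hv0).2 hv1, inv_strictAnti₀ hρ0 hρv, fun r hr hrv => ?_,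
    fun r hrv hrρ => ?_⟩
  · have hr1 : v ≤ r⁻¹ := (le_inv_comm₀ hr hv0).1 hrv
    set T := max (critRatio p) (4 * r⁻¹) with hT
    have hT0 : 0 < T := lt_max_of_lt_left hcp
    have hTv : r⁻¹ ≤ α * treeEigenvalue p T + β * treeEigenvalue q T := by
      have h1 := le_treeEigenvalue hp hT0
      have h2 := le_treeEigenvalue hq hT0
      have h3 : 4 * r⁻¹ ≤ T := le_max_right _ _
      have h4 : r⁻¹ = α * r⁻¹ + β * r⁻¹ := by rw [← add_mul, hαβ, one_mul]
      rw [h4]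
      apply add_le_add <;> apply mul_le_mul_of_nonneg_left _ (by linarith) <;> linarith
    obtain ⟨t, ht, htv⟩ := intermediate_value_Icc (le_max_left (critRatio p) (4 * r⁻¹))
      (((continuousOn_treeEigenvalue p hcp).const_mul α).add
        ((continuousOn_treeEigenvalue q hcp).const_mul β)) ⟨hr1, hTv⟩
    have hrt : r * (α * treeEigenvalue p t + β * treeEigenvalue q t) = 1 := by
      exact (congrArg (r * ·) htv).trans (mul_inv_cancel₀ hr.ne')
    exact ⟨t, hcp.trans_le ht.1,
      not_summable_powWeight_of_supercritical hα hβ hp hlt hr ht.1 hrt,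
      fun t' h0 h1 => summable_powWeight_of_lt hα hβ hp hlt hr ht.1 hrt h0 h1⟩
  · have hr : 0 < r := (inv_pos.2 hv0).trans hrv
    have hr1 : r⁻¹ < v := (inv_lt_comm₀ hv0 hr).1 hrv
    have hr2 : ρ < r⁻¹ := (lt_inv_comm₀ hr hρ0).1 hrρ
    obtain ⟨t, ht, htv⟩ := intermediate_value_Ioo hc.le
      ((continuousOn_const (c := α * treeEigenvalue p (critRatio p))).add
        ((continuousOn_treeEigenvalue q hcq).const_mul β)) ⟨hr2, hr1⟩
    have hrt : r * (α * treeEigenvalue p (critRatio p) + β * treeEigenvalue q t) = 1 := by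
      exact (congrArg (r * ·) htv).trans (mul_inv_cancel₀ hr.ne')
    exact ⟨t, hcq.trans ht.1,
      summable_powWeight_of_intermediate hα hβ hp hlt hr ht.1 ht.2 hrt,
      fun t' h => not_summable_powWeight_of_intermediate hα hβ hp hlt hr ht.1 hrt h⟩

/-! ### Word length and the random walk on the product of free groups -/

section FreeGroupNorm

variable {k : ℕ}

/-- The letters of the free group of rank `k`. -/
def letter (l : Fin k × Bool) : FreeGroup (Fin k) := FreeGroup.mk [l]

lemma letter_ne_one (l : Fin k × Bool) : letter l ≠ 1 := by
  intro h
  have := congrArg FreeGroup.toWord h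
  simp [letter, FreeGroup.toWord_mk] at this

lemma letter_injective : Function.Injective (letter (k := k)) := by
  intro l l' h
  have := congrArg FreeGroup.toWord h
  simpa [letter, FreeGroup.toWord_mk] using this

lemma exists_letter_iff (x : FreeGroup (Fin k)) :
    (∃ i : Fin k, x = FreeGroup.of i ∨ x = (FreeGroup.of i)⁻¹) ↔ ∃ l, x = letter l := by
  constructor
  · rintro ⟨i, rfl | rfl⟩
    · exact ⟨(i, true), rfl⟩
    · exact ⟨(i, false), rfl⟩
  · rintro ⟨⟨i, _ | _⟩, rfl⟩
    · exact ⟨i, Or.inr rfl⟩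
    · exact ⟨i, Or.inl rfl⟩

lemma norm_letter_mul (l : Fin k × Bool) (x : FreeGroup (Fin k)) :
    (letter l * x).norm = match x.toWord with
      | [] => 1
      | hd :: tl => if l = (hd.1, !hd.2) then tl.length else tl.length + 2 := by
  have h : (letter l * x).toWord = FreeGroup.reduce (l :: x.toWord) := by
    rw [letter, FreeGroup.toWord_mul, FreeGroup.toWord_mk]
    simp
  rw [FreeGroup.norm, h, FreeGroup.reduce.cons, FreeGroup.reduce_toWord]
  cases x.toWord with
  | nil => rfl
  | cons hd tl =>
    have : (l.1 = hd.1 ∧ l.2 = !hd.2) ↔ l = (hd.1, !hd.2) := by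
      rw [Prod.ext_iff]
    simp only [this]
    split_ifs <;> simp

/-- Averaging a radial function over the letters. -/
lemma sum_letter_mul (hk : 2 ≤ k) (u : ℕ → ℝ) (x : FreeGroup (Fin k)) :
    1 / 2 * u x.norm + ∑ l : Fin k × Bool, 1 / (4 * (k : ℝ)) * u (letter l * x).norm =
      radialOp (2 * k - 1) u x.norm := by
  have hk0 : (k : ℝ) ≠ 0 := by positivity
  rw [← Finset.mul_sum]
  simp only [norm_letter_mul]
  rcases hx : x.toWord with _ | ⟨hd, tl⟩
  · have hn : x.norm = 0 := by rw [FreeGroup.norm, hx]; rfl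
    rw [hn, radialOp_zero]
    simp only [Finset.sum_const, Finset.card_univ, Fintype.card_prod, Fintype.card_fin,
      Fintype.card_bool, nsmul_eq_mul]
    push_cast
    field_simp
    ring
  · have hn : x.norm = tl.length + 1 := by rw [FreeGroup.norm, hx]; rfl
    rw [hn, radialOp_succ]
    simp only [apply_ite u]
    have hs : ∑ l : Fin k × Bool, (if l = (hd.1, !hd.2) then u tl.length
        else u (tl.length + 2)) = u tl.length + (2 * k - 1) * u (tl.length + 2) := by
      have : ∀ l : Fin k × Bool, (if l = (hd.1, !hd.2) then u tl.length
          else u (tl.length + 2)) = (if l = (hd.1, !hd.2) then u tl.length - u (tl.length + 2)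
          else 0) + u (tl.length + 2) := fun l => by split_ifs <;> ring
      simp only [this, Finset.sum_add_distrib, Finset.sum_ite_eq', Finset.mem_univ, if_true,
        Finset.sum_const, Finset.card_univ, Fintype.card_prod, Fintype.card_fin,
        Fintype.card_bool, nsmul_eq_mul]
      push_cast
      ring
    rw [hs]
    have : (2 * ((2 * (k : ℝ) - 1) + 1)) = 4 * k := by ring
    rw [this]; ring

lemma lazyFreeSRW_eq (x : FreeGroup (Fin k)) :
    lazyFreeSRW k x = (if x = 1 then 1 / 2 else 0) +
      ∑ l : Fin k × Bool, if x = letter l then 1 / (4 * (k : ℝ)) else 0 := by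
  unfold lazyFreeSRW
  simp only [exists_letter_iff]
  by_cases h1 : x = 1
  · have : ∀ l : Fin k × Bool, ¬ x = letter l := fun l h => letter_ne_one l (h ▸ h1)
    simp [h1, (letter_ne_one _).symm]
  · rw [if_neg h1, if_neg h1, zero_add]
    by_cases h2 : ∃ l : Fin k × Bool, x = letter l
    · obtain ⟨l, rfl⟩ := h2
      rw [if_pos ⟨l, rfl⟩]
      simp [letter_injective.eq_iff]
    · rw [if_neg h2]
      push Not at h2
      simp [h2]

end FreeGroupNorm

section BiFree

variable {n m : ℕ}

lemma inl_mem_pow (L : List (Fin n × Bool)) :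
    ((FreeGroup.mk L, 1) : BiFree n m) ∈
      ((biFreeGens n m : Set (BiFree n m)) ∪ (biFreeGens n m : Set (BiFree n m))⁻¹) ^
        L.length := by
  induction L with
  | nil => simp only [List.length_nil, pow_zero, ← FreeGroup.one_eq_mk]; rfl
  | cons l L ih =>
    have e : ((FreeGroup.mk (l :: L), 1) : BiFree n m) = (letter l, 1) * (FreeGroup.mk L, 1) := by
      simp [letter]
    rw [e, List.length_cons, pow_succ']
    refine Set.mul_mem_mul ?_ ih
    rcases l with ⟨i, _ | _⟩
    · right
      simp only [Set.mem_inv, biFreeGens, Finset.coe_union, Finset.coe_image]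
      exact Or.inl ⟨i, by simp, by simp [letter, FreeGroup.of, FreeGroup.invRev]⟩
    · left
      simp only [biFreeGens, Finset.coe_union, Finset.coe_image]
      exact Or.inl ⟨i, by simp, rfl⟩

lemma inr_mem_pow (L : List (Fin m × Bool)) :
    ((1, FreeGroup.mk L) : BiFree n m) ∈
      ((biFreeGens n m : Set (BiFree n m)) ∪ (biFreeGens n m : Set (BiFree n m))⁻¹) ^
        L.length := by
  induction L with
  | nil => simp only [List.length_nil, pow_zero, ← FreeGroup.one_eq_mk]; rfl
  | cons l L ih =>
    have e : ((1, FreeGroup.mk (l :: L)) : BiFree n m) = (1, letter l) * (1, FreeGroup.mk L) := by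
      simp [letter]
    rw [e, List.length_cons, pow_succ']
    refine Set.mul_mem_mul ?_ ih
    rcases l with ⟨i, _ | _⟩
    · right
      simp only [Set.mem_inv, biFreeGens, Finset.coe_union, Finset.coe_image]
      exact Or.inr ⟨i, by simp, by simp [letter, FreeGroup.of, FreeGroup.invRev]⟩
    · left
      simp only [biFreeGens, Finset.coe_union, Finset.coe_image]
      exact Or.inr ⟨i, by simp, rfl⟩

lemma norm_add_norm_le_of_mem_gens {x : BiFree n m}
    (hx : x ∈ (biFreeGens n m : Set (BiFree n m)) ∪ (biFreeGens n m : Set (BiFree n m))⁻¹) :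
    x.1.norm + x.2.norm ≤ 1 := by
  have key : ∀ y : BiFree n m, y ∈ biFreeGens n m → y.1.norm + y.2.norm ≤ 1 := by
    intro y hy
    simp only [biFreeGens, Finset.mem_union, Finset.mem_image, Finset.mem_univ, true_and] at hy
    rcases hy with ⟨i, rfl⟩ | ⟨i, rfl⟩ <;> simp
  rcases hx with hx | hx
  · exact key x (by simpa using hx)
  · have := key x⁻¹ (by simpa using hx)
    simpa using this

lemma norm_add_norm_le_of_mem_pow (k : ℕ) {x : BiFree n m}
    (hx : x ∈ ((biFreeGens n m : Set (BiFree n m)) ∪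
      (biFreeGens n m : Set (BiFree n m))⁻¹) ^ k) : x.1.norm + x.2.norm ≤ k := by
  induction k generalizing x with
  | zero =>
    rw [pow_zero, Set.mem_one] at hx
    simp [hx]
  | succ k ih =>
    rw [pow_succ] at hx
    obtain ⟨y, hy, z, hz, rfl⟩ := Set.mem_mul.1 hx
    have h1 := ih hy
    have h2 := norm_add_norm_le_of_mem_gens hz
    have h3 := FreeGroup.norm_mul_le y.1 z.1
    have h4 := FreeGroup.norm_mul_le y.2 z.2
    simp only [Prod.fst_mul, Prod.snd_mul]
    omega

lemma wordLength_biFree (x : BiFree n m) :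
    wordLength (biFreeGens n m) x = x.1.norm + x.2.norm := by
  have hmem : x ∈ ((biFreeGens n m : Set (BiFree n m)) ∪
      (biFreeGens n m : Set (BiFree n m))⁻¹) ^ (x.1.norm + x.2.norm) := by
    have h1 := inl_mem_pow (m := m) x.1.toWord
    have h2 := inr_mem_pow (n := n) x.2.toWord
    rw [FreeGroup.mk_toWord] at h1 h2
    have := Set.mul_mem_mul h1 h2
    rw [← pow_add] at this
    simpa [FreeGroup.norm] using this
  apply le_antisymm
  · exact Nat.sInf_le hmem
  · exact norm_add_norm_le_of_mem_pow _ (Nat.sInf_mem (s := {k : ℕ | x ∈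
      ((biFreeGens n m : Set (BiFree n m)) ∪ (biFreeGens n m : Set (BiFree n m))⁻¹) ^ k}) ⟨_, hmem⟩)

/-- The one-step average of a function under left multiplication. -/
noncomputable def stepAverage (n m : ℕ) (α₁ α₂ : ℝ) (F : BiFree n m → ℝ) : ℝ :=
  α₁ * (1 / 2 * F 1 + ∑ l : Fin n × Bool, 1 / (4 * (n : ℝ)) * F (letter l, 1)) +
    α₂ * (1 / 2 * F 1 + ∑ l : Fin m × Bool, 1 / (4 * (m : ℝ)) * F (1, letter l))

lemma hasSum_of_forall_eq {ι : Type*} {f g : ι → ℝ} {a : ℝ} (h : HasSum g a)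
    (hfg : ∀ i, f i = g i) : HasSum f a := by
  rwa [funext hfg]

lemma hasSum_biFreeMu (α₁ α₂ : ℝ) (F : BiFree n m → ℝ) :
    HasSum (fun z => biFreeMu n m α₁ α₂ z * F z) (stepAverage n m α₁ α₂ F) := by
  have hpt : ∀ (g : BiFree n m) (c : ℝ), HasSum (fun z => (if z = g then c else 0) * F z)
      (c * F g) := fun g c => by
    convert hasSum_ite_eq g (c * F g) using 2 with z
    split_ifs with h
    · rw [h]
    · rw [zero_mul]
  have h := (((hpt 1 (1 / 2)).add (hasSum_sum fun (l : Fin n × Bool) (_ : l ∈ Finset.univ) =>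
      hpt (letter l, 1) (1 / (4 * (n : ℝ))))).mul_left α₁).add
    (((hpt 1 (1 / 2)).add (hasSum_sum fun (l : Fin m × Bool) (_ : l ∈ Finset.univ) =>
      hpt (1, letter l) (1 / (4 * (m : ℝ))))).mul_left α₂)
  refine hasSum_of_forall_eq h fun ⟨x, y⟩ => ?_
  simp only [biFreeMu, lazyFreeSRW_eq, Prod.mk_eq_one, Prod.mk.injEq, ← Finset.sum_mul, ← add_mul,
    ← mul_assoc]
  congr 1
  by_cases hx : x = 1 <;> by_cases hy : y = 1 <;> simp [hx, hy]

lemma hasSum_stepAverage {ι : Type*} (α₁ α₂ : ℝ) {g : BiFree n m → ι → ℝ} {A : BiFree n m → ℝ}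
    (h : ∀ y, HasSum (g y) (A y)) :
    HasSum (fun x => stepAverage n m α₁ α₂ fun y => g y x) (stepAverage n m α₁ α₂ A) :=
  ((((h 1).mul_left (1 / 2)).add (hasSum_sum fun (l : Fin n × Bool) (_ : l ∈ Finset.univ) =>
      (h (letter l, 1)).mul_left (1 / (4 * (n : ℝ))))).mul_left α₁).add
    ((((h 1).mul_left (1 / 2)).add (hasSum_sum fun (l : Fin m × Bool) (_ : l ∈ Finset.univ) =>
      (h (1, letter l)).mul_left (1 / (4 * (m : ℝ))))).mul_left α₂)

lemma stepAverage_mul_left (α₁ α₂ c : ℝ) (F : BiFree n m → ℝ) :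
    stepAverage n m α₁ α₂ (fun y => c * F y) = c * stepAverage n m α₁ α₂ F := by
  simp only [stepAverage, mul_left_comm _ c, ← Finset.mul_sum, ← mul_add]

lemma convPow_biFree_succ (α₁ α₂ : ℝ) (k : ℕ) (x : BiFree n m) :
    convPow (biFreeMu n m α₁ α₂) (k + 1) x =
      stepAverage n m α₁ α₂ fun y => convPow (biFreeMu n m α₁ α₂) k (y⁻¹ * x) :=
  (hasSum_biFreeMu α₁ α₂ fun y => convPow (biFreeMu n m α₁ α₂) k (y⁻¹ * x)).tsum_eq

/-- The Markov operator of the walk driven by `biFreeMu`. -/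
noncomputable def markovOp (n m : ℕ) (α₁ α₂ : ℝ) (f : BiFree n m → ℝ) (x : BiFree n m) : ℝ :=
  stepAverage n m α₁ α₂ fun y => f (y * x)

lemma hasSum_convPow_mul (α₁ α₂ : ℝ) (k : ℕ) (f : BiFree n m → ℝ) :
    HasSum (fun x => convPow (biFreeMu n m α₁ α₂) k x * f x)
      ((markovOp n m α₁ α₂)^[k] f 1) := by
  induction k generalizing f with
  | zero =>
    rw [Function.iterate_zero, id]
    convert hasSum_ite_eq (1 : BiFree n m) (f 1) using 2 with x
    simp only [convPow]
    split_ifs with h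
    · rw [h, one_mul]
    · rw [zero_mul]
  | succ k ih =>
    have h1 : ∀ y : BiFree n m, HasSum (fun x => convPow (biFreeMu n m α₁ α₂) k (y⁻¹ * x) * f x)
        ((markovOp n m α₁ α₂)^[k] (fun x => f (y * x)) 1) := fun y => by
      rw [← (Equiv.mulLeft y).hasSum_iff]
      simpa [Function.comp_def] using ih fun x => f (y * x)
    have h2 := hasSum_stepAverage α₁ α₂ h1
    have h3 := hasSum_stepAverage α₁ α₂ fun y => ih fun x => f (y * x)
    simp only [stepAverage_mul_left] at h3
    rw [h3.unique (ih (markovOp n m α₁ α₂ f))] at h2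
    rw [Function.iterate_succ_apply]
    refine hasSum_of_forall_eq h2 fun x => ?_
    rw [convPow_biFree_succ, mul_comm, ← stepAverage_mul_left]
    simp only [mul_comm]

lemma markovOp_radial (hn : 2 ≤ n) (hm : 2 ≤ m) (α₁ α₂ : ℝ) (w : ℕ → ℕ → ℝ) :
    markovOp n m α₁ α₂ (fun x => w x.1.norm x.2.norm) =
      fun x => biradialOp α₁ α₂ (2 * n - 1) (2 * m - 1) w x.1.norm x.2.norm := by
  funext x
  have h1 := sum_letter_mul hn (fun i => w i x.2.norm) x.1
  have h2 := sum_letter_mul hm (w x.1.norm) x.2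
  simp only [markovOp, stepAverage, one_mul, Prod.fst_mul, Prod.snd_mul]
  rw [h1, h2, biradialOp]

lemma hasSum_convPow_radial (hn : 2 ≤ n) (hm : 2 ≤ m) (α₁ α₂ : ℝ) (k : ℕ) (w : ℕ → ℕ → ℝ) :
    HasSum (fun x => convPow (biFreeMu n m α₁ α₂) k x * w x.1.norm x.2.norm)
      (biradialExp α₁ α₂ (2 * n - 1) (2 * m - 1) k w) := by
  have h : ∀ w : ℕ → ℕ → ℝ, (markovOp n m α₁ α₂)^[k] (fun x => w x.1.norm x.2.norm) 1 =
      biradialExp α₁ α₂ (2 * n - 1) (2 * m - 1) k w := by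
    induction k with
    | zero => intro w; simp [biradialExp_zero]
    | succ k ih =>
      intro w
      rw [Function.iterate_succ_apply, markovOp_radial hn hm, ih, biradialExp_succ]
  rw [← h]
  exact hasSum_convPow_mul α₁ α₂ k _

lemma convPow_nonneg {G : Type*} [Group G] {μ : G → ℝ} (hμ : ∀ x, 0 ≤ μ x) (k : ℕ) (x : G) :
    0 ≤ convPow μ k x := by
  induction k generalizing x with
  | zero => simp only [convPow]; split_ifs <;> norm_num
  | succ k ih => exact tsum_nonneg fun y => mul_nonneg (hμ y) (ih _)

lemma biFreeMu_nonneg {α₁ α₂ : ℝ} (hα₁ : 0 ≤ α₁) (hα₂ : 0 ≤ α₂) (x : BiFree n m) :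
    0 ≤ biFreeMu n m α₁ α₂ x := by
  have h : ∀ (k : ℕ) (y : FreeGroup (Fin k)), 0 ≤ lazyFreeSRW k y := fun k y => by
    unfold lazyFreeSRW; split_ifs <;> positivity
  unfold biFreeMu
  apply add_nonneg <;> apply mul_nonneg <;> first | assumption | (split_ifs <;> simp [h])

lemma convPow_biFree_one (hn : 2 ≤ n) (hm : 2 ≤ m) (α₁ α₂ : ℝ) (k : ℕ) :
    convPow (biFreeMu n m α₁ α₂) k 1 =
      biradialExp α₁ α₂ (2 * n - 1) (2 * m - 1) k rootIndicator := by
  refine HasSum.unique ?_ (hasSum_convPow_radial hn hm α₁ α₂ k rootIndicator)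
  convert hasSum_ite_eq (1 : BiFree n m) (convPow (biFreeMu n m α₁ α₂) k 1) using 2 with x
  have : (x.1.norm = 0 ∧ x.2.norm = 0) ↔ x = 1 := by
    rw [FreeGroup.norm_eq_zero, FreeGroup.norm_eq_zero, Prod.ext_iff]; rfl
  simp only [rootIndicator, this]
  split_ifs with h
  · rw [h, mul_one]
  · rw [mul_zero]

end BiFree

/-! ### Exponential growth rates -/

lemma limsup_root_eq {a : ℕ → ℝ} {ρ : ℝ} (hρ : 0 < ρ) (ha : ∀ k, 0 ≤ a k)
    (hle : ∀ k, a k ≤ ρ ^ k)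
    (hge : ∀ l, 0 ≤ l → l < ρ → ∃ (c : ℝ) (M : ℕ), 0 < c ∧ ∀ k, c * l ^ k ≤ a (k + M)) :
    limsup (fun k : ℕ => a k ^ ((k : ℝ)⁻¹)) atTop = ρ := by
  have hup : ∀ᶠ k : ℕ in atTop, a k ^ ((k : ℝ)⁻¹) ≤ ρ := by
    filter_upwards [eventually_ne_atTop 0] with k hk
    calc a k ^ ((k : ℝ)⁻¹) ≤ (ρ ^ k) ^ ((k : ℝ)⁻¹) :=
          Real.rpow_le_rpow (ha k) (hle k) (by positivity)
      _ = ρ := Real.pow_rpow_inv_natCast hρ.le hk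
  have hlow : ∀ k : ℕ, 0 ≤ a k ^ ((k : ℝ)⁻¹) := fun k => Real.rpow_nonneg (ha k) _
  have hcob : IsCoboundedUnder (· ≤ ·) atTop fun k : ℕ => a k ^ ((k : ℝ)⁻¹) :=
    (isBoundedUnder_of ⟨0, hlow⟩ : IsBoundedUnder (· ≥ ·) atTop _).isCoboundedUnder_le
  refine le_antisymm (limsup_le_of_le hcob hup) (not_lt.1 fun hlt => ?_)
  obtain ⟨l, hl, hlρ⟩ := exists_between (max_lt hlt hρ)
  obtain ⟨l', hll', hl'ρ⟩ := exists_between hlρ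
  have hl0 : 0 < l := (le_max_right _ _).trans_lt hl
  obtain ⟨c, M, hc, hcM⟩ := hge l' (hl0.trans hll').le hl'ρ
  have hev : ∀ᶠ k : ℕ in atTop, a k ≤ l ^ k := by
    filter_upwards [eventually_ne_atTop 0, eventually_lt_of_limsup_lt
      ((le_max_left _ _).trans_lt hl) ⟨ρ, hup⟩] with k hk h
    have := pow_le_pow_left₀ (hlow k) h.le k
    rwa [Real.rpow_inv_natCast_pow (ha k) hk] at this
  have hev' := (tendsto_add_atTop_nat M).eventually hev
  have hbig := (tendsto_pow_atTop_atTop_of_one_lt ((one_lt_div hl0).2 hll')).eventually_gt_atTop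
    (l ^ M / c)
  obtain ⟨k, hk1, hk2⟩ := (hev'.and hbig).exists
  have h1 := (hcM k).trans hk1
  rw [div_pow, div_lt_div_iff₀ hc (by positivity)] at hk2
  rw [pow_add] at h1
  nlinarith

section SphereSum

variable {G : Type*} {L : G → ℕ} {g : G → ℝ}

lemma sphereSum_le (hg : ∀ x, 0 ≤ g x) {t : ℝ} (ht : 0 < t)
    (h : Summable fun x => g x * t ^ L x) (N : ℕ) :
    (Summable fun x => if L x = N then g x else 0) ∧
      ∑' x, (if L x = N then g x else 0) ≤ (∑' x, g x * t ^ L x) / t ^ N := by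
  have hle : ∀ x, (if L x = N then g x else 0) ≤ g x * t ^ L x / t ^ N := fun x => by
    split_ifs with hx
    · rw [hx, mul_div_cancel_right₀ _ (pow_pos ht N).ne']
    · have := hg x
      positivity
  have hs : Summable fun x => if L x = N then g x else 0 :=
    Summable.of_nonneg_of_le (fun x => by split_ifs <;> simp [hg]) hle (h.div_const _)
  exact ⟨hs, (hs.tsum_le_tsum hle (h.div_const _)).trans_eq tsum_div_const⟩

lemma summable_of_sphereSum_le (hg : ∀ x, 0 ≤ g x) {t u : ℝ} (ht : 0 < t) (hu : 0 < u)
    (hut : u * t < 1) (hs : ∀ N, Summable fun x => if L x = N then g x else 0)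
    (h : ∀ᶠ N in atTop, ∑' x, (if L x = N then g x else 0) ≤ u ^ N) :
    Summable fun x => g x * t ^ L x := by
  have hnn : 0 ≤ fun z : ℕ × G => (if L z.2 = z.1 then g z.2 else 0) * t ^ z.1 := by
    intro z
    refine mul_nonneg ?_ (pow_nonneg ht.le _)
    split_ifs <;> simp [hg]
  have hsum : Summable fun z : ℕ × G => (if L z.2 = z.1 then g z.2 else 0) * t ^ z.1 := by
    have hmul : ∀ N, Summable fun x => (if L x = N then g x else 0) * t ^ N :=
      fun N => (hs N).mul_right _
    refine (summable_prod_of_nonneg hnn).2 ⟨hmul, ?_⟩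
    simp only [tsum_mul_right]
    refine Summable.of_norm_bounded_eventually_nat
      (summable_geometric_of_lt_one (mul_pos hu ht).le hut) ?_
    filter_upwards [h] with N hN
    have h0 : 0 ≤ ∑' x, (if L x = N then g x else 0) :=
      tsum_nonneg fun x => by split_ifs <;> simp [hg]
    rw [Real.norm_of_nonneg (by positivity), mul_pow]
    gcongr
  have := ((Equiv.prodComm G ℕ).summable_iff.2 hsum).prod
  refine this.congr fun x => ?_
  simp only [Function.comp_apply, Equiv.prodComm_apply, Prod.swap, ite_mul, zero_mul]
  exact tsum_ite_eq' (L x) fun N => g x * t ^ N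

/-- The exponential growth rate of the sphere sums of `g`. -/
noncomputable def sphereGrowth (L : G → ℕ) (g : G → ℝ) : ℝ :=
  limsup (fun N : ℕ => Real.log (∑' x, if L x = N then g x else 0) / N) atTop

lemma log_sphereSum_div_le (hg : ∀ x, 0 ≤ g x) {c : ℝ} (hc : 0 < c)
    (hlow : ∀ N, c ^ N ≤ ∑' x, if L x = N then g x else 0) {t : ℝ} (ht : 0 < t)
    (h : Summable fun x => g x * t ^ L x) :
    ∀ᶠ N : ℕ in atTop, Real.log (∑' x, if L x = N then g x else 0) / N ≤
      Real.log (∑' x, g x * t ^ L x) / N - Real.log t := by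
  filter_upwards [eventually_gt_atTop 0] with N hN
  have hpos : 0 < ∑' x, if L x = N then g x else 0 := (pow_pos hc N).trans_le (hlow N)
  have hle := (sphereSum_le hg ht h N).2
  have hN' : (0 : ℝ) < N := Nat.cast_pos.2 hN
  have hC : 0 < ∑' x, g x * t ^ L x := by
    have := hpos.trans_le hle
    exact (div_pos_iff_of_pos_right (pow_pos ht N)).1 this
  have := Real.log_le_log hpos hle
  rw [Real.log_div hC.ne' (pow_pos ht N).ne', Real.log_pow] at this
  rw [div_le_iff₀ hN', sub_mul, div_mul_cancel₀ _ hN'.ne']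
  linarith

lemma tendsto_div_sub_log (C t : ℝ) :
    Tendsto (fun N : ℕ => C / N - Real.log t) atTop (nhds (-Real.log t)) := by
  simpa using (tendsto_const_div_atTop_nhds_zero_nat C).sub_const (Real.log t)

lemma le_exp_neg_sphereGrowth (hg : ∀ x, 0 ≤ g x) {c : ℝ} (hc : 0 < c)
    (hlow : ∀ N, c ^ N ≤ ∑' x, if L x = N then g x else 0) {t : ℝ} (ht : 0 < t)
    (h : Summable fun x => g x * t ^ L x) : t ≤ Real.exp (-sphereGrowth L g) := by
  have hlim := tendsto_div_sub_log (Real.log (∑' x, g x * t ^ L x)) t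
  have hge : ∀ᶠ N : ℕ in atTop,
      Real.log c ≤ Real.log (∑' x, if L x = N then g x else 0) / N := by
    filter_upwards [eventually_gt_atTop 0] with N hN
    rw [le_div_iff₀ (Nat.cast_pos.2 hN), mul_comm, ← Real.log_pow]
    exact Real.log_le_log (pow_pos hc N) (hlow N)
  have hcob : IsCoboundedUnder (· ≤ ·) atTop
      fun N : ℕ => Real.log (∑' x, if L x = N then g x else 0) / N :=
    IsBoundedUnder.isCoboundedUnder_le ⟨_, hge⟩
  have hω : sphereGrowth L g ≤ -Real.log t :=
    (limsup_le_limsup (log_sphereSum_div_le hg hc hlow ht h) hcob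
      hlim.isBoundedUnder_le).trans_eq hlim.limsup_eq
  rw [← Real.log_le_iff_le_exp ht]
  linarith

lemma exists_summable_of_lt_exp_neg_sphereGrowth (hg : ∀ x, 0 ≤ g x) {c : ℝ} (hc : 0 < c)
    (hlow : ∀ N, c ^ N ≤ ∑' x, if L x = N then g x else 0) {t : ℝ} (ht : 0 < t)
    (h : Summable fun x => g x * t ^ L x) (hlt : t < Real.exp (-sphereGrowth L g)) :
    ∃ t', t < t' ∧ Summable fun x => g x * t' ^ L x := by
  obtain ⟨v, htv, hv⟩ := exists_between hlt
  obtain ⟨t', htt', ht'v⟩ := exists_between htv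
  have hv0 : 0 < v := ht.trans htv
  refine ⟨t', htt', summable_of_sphereSum_le hg (ht.trans htt') (inv_pos.2 hv0) ?_
    (fun N => (sphereSum_le hg ht h N).1) ?_⟩
  · rwa [inv_mul_lt_iff₀ hv0, mul_one]
  have hω : sphereGrowth L g < -Real.log v := by
    rw [← Real.log_lt_iff_lt_exp hv0] at hv
    linarith
  have hbdd : IsBoundedUnder (· ≤ ·) atTop
      fun N : ℕ => Real.log (∑' x, if L x = N then g x else 0) / N :=
    (tendsto_div_sub_log _ t).isBoundedUnder_le.mono_le (log_sphereSum_div_le hg hc hlow ht h)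
  filter_upwards [eventually_gt_atTop 0, eventually_lt_of_limsup_lt hω hbdd] with N hN hlog
  have hpos : 0 < ∑' x, if L x = N then g x else 0 := (pow_pos hc N).trans_le (hlow N)
  rw [div_lt_iff₀ (Nat.cast_pos.2 hN)] at hlog
  rw [← Real.log_le_log_iff hpos (by positivity), Real.log_pow, Real.log_inv]
  linarith

end SphereSum

/-! ### Transfer to the Green function -/

section Transfer

variable {n m : ℕ} {α₁ α₂ : ℝ}

lemma one_lt_branching {k : ℕ} (hk : 2 ≤ k) : (1 : ℝ) < 2 * k - 1 := by
  have : (2 : ℝ) ≤ k := by exact_mod_cast hk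
  linarith

lemma spectralRadius_biFree (hn : 2 ≤ n) (hm : 2 ≤ m) (hα₁ : 0 < α₁) (hα₂ : 0 < α₂)
    (hα : α₁ + α₂ = 1) :
    spectralRadius (biFreeMu n m α₁ α₂) =
      α₁ * treeEigenvalue (2 * n - 1) (critRatio (2 * n - 1)) +
        α₂ * treeEigenvalue (2 * m - 1) (critRatio (2 * m - 1)) := by
  have hp := one_lt_branching hn
  have hq := one_lt_branching hm
  have h1 := treeEigenvalue_pos hp (critRatio_pos hp)
  have h2 := treeEigenvalue_pos hq (critRatio_pos hq)
  refine limsup_root_eq (by positivity)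
    (fun k => convPow_nonneg (biFreeMu_nonneg hα₁.le hα₂.le) k 1) (fun k => ?_)
    fun l hl0 hl => ?_
  · rw [convPow_biFree_one hn hm]
    exact biradialExp_root_le hα₁ hα₂ hp hq k
  · simp only [convPow_biFree_one hn hm]
    exact exists_le_biradialExp_root hα₁ hα₂ hα hp hq hl0 hl

lemma summable_biradialExp_iff (hn : 2 ≤ n) (hm : 2 ≤ m) (hα₁ : 0 ≤ α₁) (hα₂ : 0 ≤ α₂)
    {r : ℝ} (hr : 0 ≤ r) {w : ℕ → ℕ → ℝ} (hw : ∀ a b, 0 ≤ w a b) :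
    (Summable fun k => r ^ k * biradialExp α₁ α₂ (2 * n - 1) (2 * m - 1) k w) ↔
      (∀ x : BiFree n m, Summable fun k =>
        r ^ k * convPow (biFreeMu n m α₁ α₂) k x * w x.1.norm x.2.norm) ∧
      Summable fun x : BiFree n m =>
        green (biFreeMu n m α₁ α₂) r x * w x.1.norm x.2.norm := by
  have hp := convPow_nonneg (biFreeMu_nonneg (n := n) (m := m) hα₁ hα₂)
  have hnn : 0 ≤ fun z : BiFree n m × ℕ =>
      r ^ z.2 * convPow (biFreeMu n m α₁ α₂) z.2 z.1 * w z.1.1.norm z.1.2.norm := fun z =>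
    mul_nonneg (mul_nonneg (pow_nonneg hr _) (hp _ _)) (hw _ _)
  have h1 := summable_prod_of_nonneg hnn
  have h2 := summable_prod_of_nonneg (f := fun z : ℕ × BiFree n m =>
      r ^ z.1 * convPow (biFreeMu n m α₁ α₂) z.1 z.2 * w z.2.1.norm z.2.2.norm)
      fun z => hnn z.swap
  have h3 := fun k => (hasSum_convPow_radial hn hm α₁ α₂ k w).mul_left (r ^ k)
  simp only [← mul_assoc] at h3
  simp only [fun k => (h3 k).tsum_eq, fun k => (h3 k).summable, implies_true, true_and] at h2
  simp only [tsum_mul_right] at h1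
  exact h2.symm.trans ((Equiv.prodComm _ _).summable_iff.symm.trans h1)

lemma summable_convPow_of_pos (hn : 2 ≤ n) (hm : 2 ≤ m) (hα₁ : 0 ≤ α₁) (hα₂ : 0 ≤ α₂)
    {r : ℝ} (hr : 0 ≤ r) {w : ℕ → ℕ → ℝ} (hw : ∀ a b, 0 < w a b)
    (h : Summable fun k => r ^ k * biradialExp α₁ α₂ (2 * n - 1) (2 * m - 1) k w)
    (x : BiFree n m) : Summable fun k => r ^ k * convPow (biFreeMu n m α₁ α₂) k x :=
  (summable_mul_right_iff (hw _ _).ne').1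
    (((summable_biradialExp_iff hn hm hα₁ hα₂ hr fun a b => (hw a b).le).1 h).1 x)

lemma green_nonneg (hα₁ : 0 ≤ α₁) (hα₂ : 0 ≤ α₂) {r : ℝ} (hr : 0 ≤ r) (x : BiFree n m) :
    0 ≤ green (biFreeMu n m α₁ α₂) r x :=
  tsum_nonneg fun k =>
    mul_nonneg (pow_nonneg hr k) (convPow_nonneg (biFreeMu_nonneg hα₁ hα₂) k x)

lemma green_mul_powWeight (r t : ℝ) (x : BiFree n m) :
    green (biFreeMu n m α₁ α₂) r x * powWeight t x.1.norm x.2.norm =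
      green (biFreeMu n m α₁ α₂) r x * t ^ wordLength (biFreeGens n m) x := by
  rw [wordLength_biFree, pow_add]; rfl

lemma summable_green_iff (hn : 2 ≤ n) (hm : 2 ≤ m) (hα₁ : 0 ≤ α₁) (hα₂ : 0 ≤ α₂)
    {r : ℝ} (hr : 0 ≤ r)
    (hG : ∀ x : BiFree n m, Summable fun k => r ^ k * convPow (biFreeMu n m α₁ α₂) k x)
    {t : ℝ} (ht : 0 < t) :
    (Summable fun x => green (biFreeMu n m α₁ α₂) r x * t ^ wordLength (biFreeGens n m) x) ↔
      Summable fun k =>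
        r ^ k * biradialExp α₁ α₂ (2 * n - 1) (2 * m - 1) k (powWeight t) := by
  rw [summable_biradialExp_iff hn hm hα₁ hα₂ hr fun a b => (powWeight_pos ht a b).le,
    and_iff_right fun x => (hG x).mul_right _]
  simp only [green_mul_powWeight]

lemma exists_pow_le_greenSphereSum (hn : 2 ≤ n) (hm : 2 ≤ m) (hα₁ : 0 < α₁) (hα₂ : 0 < α₂)
    (hα : α₁ + α₂ = 1) {r : ℝ} (hr : 0 < r)
    (hG : ∀ x : BiFree n m, Summable fun k => r ^ k * convPow (biFreeMu n m α₁ α₂) k x)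
    {t : ℝ} (ht : 0 < t)
    (h : Summable fun x => green (biFreeMu n m α₁ α₂) r x * t ^ wordLength (biFreeGens n m) x) :
    ∃ c : ℝ, 0 < c ∧ ∀ N : ℕ,
      c ^ N ≤ greenSphereSum (biFreeGens n m) (biFreeMu n m α₁ α₂) r N := by
  obtain ⟨c, hc, hcN⟩ := exists_pow_le_biradialExp_sphere hα₁ hα₂ hα (one_lt_branching hn)
    (one_lt_branching hm)
  refine ⟨r * c, by positivity, fun N => ?_⟩
  have hp := convPow_nonneg (biFreeMu_nonneg (n := n) (m := m) hα₁.le hα₂.le)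
  have hs := (hasSum_convPow_radial hn hm α₁ α₂ N
    fun a b => if a + b = N then 1 else 0).mul_left (r ^ N)
  rw [mul_pow]
  refine (mul_le_mul_of_nonneg_left (hcN N) (by positivity)).trans ?_
  refine hasSum_le (fun x => ?_) hs
    (sphereSum_le (green_nonneg hα₁.le hα₂.le hr.le) ht h N).1.hasSum
  rw [wordLength_biFree]
  split_ifs
  · rw [mul_one]
    exact (hG x).le_tsum N fun k _ => mul_nonneg (pow_nonneg hr.le k) (hp k x)
  · simp

lemma green_mul_exp (r ω : ℝ) (x : BiFree n m) :
    green (biFreeMu n m α₁ α₂) r x * Real.exp (-ω * (wordLength (biFreeGens n m) x : ℝ)) =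
      green (biFreeMu n m α₁ α₂) r x * Real.exp (-ω) ^ wordLength (biFreeGens n m) x := by
  rw [mul_comm (-ω), Real.exp_nat_mul]

end Transfer

/-- For `Γ₀ = F_n × F_m` (`n ≠ m`, `n,m ≥ 2`) with the measure
`μ₀ = α₁ μ̂₁ + α₂ μ̂₂`, there is `r₀ ∈ (1, R₀)` such that the Poincaré series
`Θ_{Γ₀}(r, ω_{Γ₀}(r)) = Σ_x G₀(e,x|r) e^{−ω_{Γ₀}(r)|x|}` diverges for every
`0 < r ≤ r₀` and converges for every `r₀ < r < R₀`. -/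
theorem biFree_poincare_phase_transition (n m : ℕ) (hn : 2 ≤ n) (hm : 2 ≤ m)
    (hnm : n ≠ m) (α₁ α₂ : ℝ) (hα₁ : 0 < α₁) (hα₂ : 0 < α₂) (hα : α₁ + α₂ = 1) :
    ∃ r₀ : ℝ, 1 < r₀ ∧ r₀ < greenRadius (biFreeMu n m α₁ α₂) ∧
      (∀ r : ℝ, 0 < r → r ≤ r₀ →
        ¬ Summable (fun x : BiFree n m =>
          green (biFreeMu n m α₁ α₂) r x *
            Real.exp (-(greenGrowthRate (biFreeGens n m) (biFreeMu n m α₁ α₂) r) *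
              (wordLength (biFreeGens n m) x : ℝ)))) ∧
      (∀ r : ℝ, r₀ < r → r < greenRadius (biFreeMu n m α₁ α₂) →
        Summable (fun x : BiFree n m =>
          green (biFreeMu n m α₁ α₂) r x *
            Real.exp (-(greenGrowthRate (biFreeGens n m) (biFreeMu n m α₁ α₂) r) *
              (wordLength (biFreeGens n m) x : ℝ)))) := by
  obtain ⟨r₀, h1, hR, hdiv, hconv⟩ := exists_radial_phase_transition hα₁ hα₂ hα
    (one_lt_branching hn) (one_lt_branching hm)
    (p := 2 * n - 1) (q := 2 * m - 1) fun h => hnm (Nat.cast_injective (R := ℝ) (by linarith))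
  have hρ : greenRadius (biFreeMu n m α₁ α₂) = (α₁ * treeEigenvalue (2 * n - 1)
      (critRatio (2 * n - 1)) + α₂ * treeEigenvalue (2 * m - 1) (critRatio (2 * m - 1)))⁻¹ := by
    rw [greenRadius, spectralRadius_biFree hn hm hα₁ hα₂ hα]
  have hg : ∀ {r : ℝ}, 0 < r → ∀ x : BiFree n m, 0 ≤ green (biFreeMu n m α₁ α₂) r x :=
    fun hr x => green_nonneg hα₁.le hα₂.le hr.le x
  simp only [hρ, green_mul_exp]
  refine ⟨r₀, h1, hR, fun r hr hle hsum => ?_, fun r hlt hrR => ?_⟩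
  · obtain ⟨t, ht, hnot, hbelow⟩ := hdiv r hr hle
    have hG := summable_convPow_of_pos hn hm hα₁.le hα₂.le hr.le (powWeight_pos (half_pos ht))
      (hbelow (t / 2) (half_pos ht) (half_lt_self ht))
    have hiff {s : ℝ} (hs : 0 < s) := summable_green_iff hn hm hα₁.le hα₂.le hr.le hG hs
    obtain ⟨c, hc, hlow⟩ := exists_pow_le_greenSphereSum hn hm hα₁ hα₂ hα hr hG (half_pos ht)
      ((hiff (half_pos ht)).2 (hbelow _ (half_pos ht) (half_lt_self ht)))
    have hω : t ≤ Real.exp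
        (-greenGrowthRate (biFreeGens n m) (biFreeMu n m α₁ α₂) r) := by
      refine le_of_forall_lt_imp_le_of_dense fun t' ht' => ?_
      rcases le_or_gt t' 0 with h0 | h0
      · exact h0.trans (Real.exp_pos _).le
      · exact le_exp_neg_sphereGrowth (hg hr) hc hlow h0 ((hiff h0).2 (hbelow t' h0 ht'))
    refine hnot (summable_biradialExp_mono hα₁ hα₂ (one_lt_branching hn) (one_lt_branching hm) hr
      (C := 1) (fun a b => (powWeight_pos ht a b).le) (fun a b => ?_)
      ((hiff (Real.exp_pos _)).1 hsum))
    rw [one_mul]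
    exact powWeight_mono ht.le hω a b
  · obtain ⟨t, ht, hsum, habove⟩ := hconv r hlt hrR
    have hr : 0 < r := by linarith
    have hG := summable_convPow_of_pos hn hm hα₁.le hα₂.le hr.le (powWeight_pos ht) hsum
    have hiff {s : ℝ} (hs : 0 < s) := summable_green_iff hn hm hα₁.le hα₂.le hr.le hG hs
    have hsum' := (hiff ht).2 hsum
    obtain ⟨c, hc, hlow⟩ := exists_pow_le_greenSphereSum hn hm hα₁ hα₂ hα hr hG ht hsum'
    refine Summable.of_nonneg_of_le (fun x => mul_nonneg (hg hr x) (by positivity))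
      (fun x => mul_le_mul_of_nonneg_left (pow_le_pow_left₀ (Real.exp_pos _).le ?_ _) (hg hr x))
      hsum'
    refine not_lt.1 fun hlt' => ?_
    obtain ⟨t', htt', ht'⟩ :=
      exists_summable_of_lt_exp_neg_sphereGrowth (hg hr) hc hlow ht hsum' hlt'
    exact habove t' htt' ((hiff (ht.trans htt')).1 ht')

end GreenGrowth
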